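/- There exists ε₀ > 0 such that for every ε ∈ (0, ε₀) and every constant α ∈ (0, ε⁸) the following holds, where x = x(ε) is the unique solution in (0,1) of x = (1+ε)(1 − e^{−x}). For every γ > 0 there exist β > 0 and n₀ ∈ ℕ such that for all n ≥ n₀, all d with 1 + ε ≤ d ≤ β·n, and every (n,d,λ)-graph G with λ/d ≤ α^{2/α}: setting p = (1+ε)/d, with probability at least 1 − γ the number e(L₁) of edges of the largest connected component L₁ of the p-site-percolated subgraph G_p satisfies | e(L₁) − ((1+ε)² − (1+ε−x)²)·n/(2d) | ≤ 8·α^{1/4}·n/d. -/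

import Mathlib

open Finset

/-- The adjacency matrix of `G` over `ℝ` is Hermitian. -/
noncomputable def SimpleGraph.adjHermitian {n : ℕ} (G : SimpleGraph (Fin n)) :
    letI := Classical.decRel G.Adj
    ((G.adjMatrix ℝ).IsHermitian) := by
  letI := Classical.decRel G.Adj
  rw [Matrix.IsHermitian, Matrix.conjTranspose_eq_transpose_of_trivial]
  exact G.isSymm_adjMatrix

/-- `G` is an `(n,d,λ)`-graph: a `d`-regular graph on `n` vertices all of whose
adjacency-matrix eigenvalues, except one eigenvalue equal to `d`, have absolute
value at most `lam`. -/
noncomputable def IsNDLGraph (n d : ℕ) (lam : ℝ) (G : SimpleGraph (Fin n)) : Prop :=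
  letI := Classical.decRel G.Adj
  G.IsRegularOfDegree d ∧
    ∃ i₀ : Fin n, (G.adjHermitian.eigenvalues i₀ = d ∧
      ∀ i : Fin n, i ≠ i₀ → |G.adjHermitian.eigenvalues i| ≤ lam)

/-- `G` has an induced path on `k` vertices. -/
def HasInducedPath {V : Type*} (G : SimpleGraph V) (k : ℕ) : Prop :=
  ∃ f : Fin k → V, Function.Injective f ∧
    ∀ i j : Fin k, G.Adj (f i) (f j) ↔ ((i : ℕ) + 1 = (j : ℕ) ∨ (j : ℕ) + 1 = (i : ℕ))

/-- `G` has an induced cycle of length `k`. -/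
def HasInducedCycle {V : Type*} (G : SimpleGraph V) (k : ℕ) : Prop :=
  3 ≤ k ∧ ∃ f : ZMod k → V, Function.Injective f ∧
    ∀ i j : ZMod k, G.Adj (f i) (f j) ↔ (i - j = 1 ∨ j - i = 1)

open MeasureTheory in
/-- The Bernoulli measure on `Bool` with success probability `p`. -/
noncomputable def bernoulliMeasure (p : ℝ) : Measure Bool :=
  (ENNReal.ofReal p) • Measure.dirac true + (ENNReal.ofReal (1 - p)) • Measure.dirac false

open MeasureTheory in
/-- The site-percolation measure on subsets of `V` (encoded as functions `V → Bool`):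
every vertex is retained independently with probability `p`. -/
noncomputable def percolationMeasure (V : Type*) [Fintype V] (p : ℝ) :
    Measure (V → Bool) :=
  Measure.pi fun _ : V => bernoulliMeasure p

/-- The vertex set retained by the percolation outcome `ω`. -/
def percSet {V : Type*} (ω : V → Bool) : Set V := {v : V | ω v = true}

/-- The expectation of `f S`, where `S` is a random subset of `U` containing each element of `U`
independently with probability `p`. -/
noncomputable def bexp {V : Type*} (p : ℝ) (U : Finset V) (f : Finset V → ℝ) : ℝ :=
  ∑ S ∈ U.powerset, p ^ #S * (1 - p) ^ (#U - #S) * f S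

section RandomSubset

variable {V : Type*} {p : ℝ} {U : Finset V} {f g : Finset V → ℝ}

theorem bexp_empty : bexp p ∅ f = f ∅ := by simp [bexp]

theorem bexp_congr (h : ∀ S ⊆ U, f S = g S) : bexp p U f = bexp p U g :=
  sum_congr rfl fun S hS => by rw [h S (mem_powerset.1 hS)]

theorem bexp_add : bexp p U (fun S => f S + g S) = bexp p U f + bexp p U g := by
  simp only [bexp, mul_add, sum_add_distrib]

theorem bexp_const_mul (c : ℝ) : bexp p U (fun S => c * f S) = c * bexp p U f := by
  simp only [bexp, mul_sum]
  exact sum_congr rfl fun S _ => by ring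

theorem bexp_sum {ι : Type*} (s : Finset ι) (F : ι → Finset V → ℝ) :
    bexp p U (fun S => ∑ i ∈ s, F i S) = ∑ i ∈ s, bexp p U (F i) := by
  simp only [bexp, mul_sum]
  exact sum_comm

theorem bexp_mono (h0 : 0 ≤ p) (h1 : p ≤ 1) (h : ∀ S ⊆ U, f S ≤ g S) :
    bexp p U f ≤ bexp p U g :=
  sum_le_sum fun S hS => mul_le_mul_of_nonneg_left (h S (mem_powerset.1 hS))
    (mul_nonneg (pow_nonneg h0 _) (pow_nonneg (sub_nonneg.2 h1) _))

theorem bexp_nonneg (h0 : 0 ≤ p) (h1 : p ≤ 1) (h : ∀ S ⊆ U, 0 ≤ f S) : 0 ≤ bexp p U f := by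
  simpa [bexp] using bexp_mono (f := fun _ => 0) h0 h1 h

/-- The probability that a random subset satisfies `P`. -/
noncomputable def bprob (p : ℝ) (U : Finset V) (P : Finset V → Prop) : ℝ :=
  bexp p U fun S => open Classical in if P S then 1 else 0

variable [DecidableEq V]

theorem bexp_insert {w : V} (hw : w ∉ U) :
    bexp p (insert w U) f = (1 - p) * bexp p U f + p * bexp p U (fun S => f (insert w S)) := by
  rw [bexp, sum_powerset_insert hw, bexp, bexp, mul_sum, mul_sum]
  congr 1
  · refine sum_congr rfl fun S hS => ?_
    have h := card_le_card (mem_powerset.1 hS)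
    rw [card_insert_of_notMem hw, Nat.succ_sub h, pow_succ]
    ring
  · refine sum_congr rfl fun S hS => ?_
    have h : w ∉ S := fun h => hw (mem_powerset.1 hS h)
    rw [card_insert_of_notMem hw, card_insert_of_notMem h, Nat.add_sub_add_right, pow_succ]
    ring

theorem bexp_const (c : ℝ) : bexp p U (fun _ => c) = c := by
  induction U using Finset.induction_on with
  | empty => exact bexp_empty
  | insert w U hw ih => rw [bexp_insert hw, ih]; ring

theorem bexp_split {w : V} (hw : w ∈ U) :
    bexp p U f = p * bexp p U (fun S => f (insert w S)) +
      (1 - p) * bexp p U (fun S => f (S.erase w)) := by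
  obtain ⟨U', hw', rfl⟩ : ∃ U', w ∉ U' ∧ insert w U' = U :=
    ⟨U.erase w, notMem_erase w U, insert_erase hw⟩
  have key : bexp p U' (fun S => f (S.erase w)) = bexp p U' f :=
    bexp_congr fun S hS => by rw [erase_eq_of_notMem fun h => hw' (hS h)]
  have key' : bexp p U' (fun S => f ((insert w S).erase w)) = bexp p U' f :=
    bexp_congr fun S hS => by rw [erase_insert fun h => hw' (hS h)]
  simp only [bexp_insert hw', insert_idem, key, key']
  ring

theorem bexp_union (a b : ℝ) :
    bexp a U (fun S => bexp b U (fun S' => f (S ∪ S'))) = bexp (1 - (1 - a) * (1 - b)) U f := by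
  induction U using Finset.induction_on generalizing f with
  | empty => simp [bexp_empty]
  | insert w U hw ih =>
    simp only [bexp_insert hw, bexp_add, bexp_const_mul, union_insert, insert_union, insert_idem,
      ih (f := f), ih (f := fun S => f (insert w S))]
    ring

theorem bexp_pow_card_inter (t : ℝ) (X : Finset V) :
    bexp p U (fun S => t ^ #(S ∩ X)) = (1 - p + p * t) ^ #(U ∩ X) := by
  induction U using Finset.induction_on with
  | empty => simp [bexp_empty]
  | insert w U hw ih =>
    rw [bexp_insert hw, ih]
    by_cases hX : w ∈ X
    · have : bexp p U (fun S => t ^ #(insert w S ∩ X)) = t * (1 - p + p * t) ^ #(U ∩ X) := by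
        rw [← ih, ← bexp_const_mul]
        refine bexp_congr fun S hS => ?_
        rw [insert_inter_of_mem hX, card_insert_of_notMem fun h => hw (hS (mem_inter.1 h).1),
          pow_succ']
      rw [this, insert_inter_of_mem hX, card_insert_of_notMem fun h => hw (mem_inter.1 h).1]
      ring
    · simp only [insert_inter_of_notMem hX, ih]
      ring

theorem bexp_card_inter (X : Finset V) :
    bexp p U (fun S => (#(S ∩ X) : ℝ)) = p * #(U ∩ X) := by
  induction U using Finset.induction_on with
  | empty => simp [bexp_empty]
  | insert w U hw ih =>
    rw [bexp_insert hw, ih]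
    by_cases hX : w ∈ X
    · have : bexp p U (fun S => (#(insert w S ∩ X) : ℝ)) = p * #(U ∩ X) + 1 := by
        rw [← ih, ← bexp_const (p := p) (U := U) 1, ← bexp_add]
        refine bexp_congr fun S hS => ?_
        rw [insert_inter_of_mem hX, card_insert_of_notMem fun h => hw (hS (mem_inter.1 h).1)]
        simp
      rw [this, insert_inter_of_mem hX, card_insert_of_notMem fun h => hw (mem_inter.1 h).1]
      push_cast
      ring
    · simp only [insert_inter_of_notMem hX, ih]
      ring

theorem bexp_card_inter_sq (X : Finset V) :
    bexp p U (fun S => (#(S ∩ X) : ℝ) ^ 2) =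
      p * #(U ∩ X) + p ^ 2 * (#(U ∩ X) : ℝ) * (#(U ∩ X) - 1) := by
  induction U using Finset.induction_on with
  | empty => simp [bexp_empty]
  | insert w U hw ih =>
    rw [bexp_insert hw, ih]
    by_cases hX : w ∈ X
    · have : bexp p U (fun S => (#(insert w S ∩ X) : ℝ) ^ 2) =
          bexp p U (fun S => (#(S ∩ X) : ℝ) ^ 2 + (2 * (#(S ∩ X) : ℝ) + 1)) := by
        refine bexp_congr fun S hS => ?_
        rw [insert_inter_of_mem hX, card_insert_of_notMem fun h => hw (hS (mem_inter.1 h).1)]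
        push_cast
        ring
      rw [this, bexp_add, ih, bexp_add, bexp_const_mul, bexp_card_inter, bexp_const,
        insert_inter_of_mem hX, card_insert_of_notMem fun h => hw (mem_inter.1 h).1]
      push_cast
      ring
    · simp only [insert_inter_of_notMem hX, ih]
      ring

/-- Second moment of a binomial variable. -/
theorem bexp_card_inter_sq_le (h0 : 0 ≤ p) (X : Finset V) :
    bexp p U (fun S => (#(S ∩ X) : ℝ) ^ 2) ≤ p * #X + (p * #X) ^ 2 := by
  have h : (#(U ∩ X) : ℝ) ≤ #X := by exact_mod_cast card_le_card inter_subset_right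
  have h' : (0 : ℝ) ≤ #(U ∩ X) := by positivity
  rw [bexp_card_inter_sq]
  have h2 : p ^ 2 * (#(U ∩ X) : ℝ) * (#(U ∩ X) - 1) ≤ (p * #X) ^ 2 := by
    have : (#(U ∩ X) : ℝ) * (#(U ∩ X) - 1) ≤ (#X : ℝ) ^ 2 := by nlinarith
    nlinarith [sq_nonneg p]
  nlinarith

theorem bexp_sq_le (h0 : 0 ≤ p) (h1 : p ≤ 1) : (bexp p U f) ^ 2 ≤ bexp p U (fun S => f S ^ 2) := by
  have h := bexp_nonneg (f := fun S => (f S - bexp p U f) ^ 2) (U := U) h0 h1 fun S _ => sq_nonneg _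
  have e : bexp p U (fun S => (f S - bexp p U f) ^ 2) =
      bexp p U (fun S => f S ^ 2) + (-2 * bexp p U f * bexp p U f + bexp p U f ^ 2) := by
    rw [← bexp_const_mul, ← bexp_const (p := p) (U := U) (bexp p U f ^ 2), ← bexp_add, ← bexp_add]
    exact bexp_congr fun S _ => by ring
  nlinarith

/-- The **Efron–Stein inequality** for random subsets. -/
theorem efron_stein (h0 : 0 ≤ p) (h1 : p ≤ 1) :
    bexp p U (fun S => f S ^ 2) - bexp p U f ^ 2 ≤
      p * ∑ v ∈ U, bexp p U (fun S => (f (insert v S) - f (S.erase v)) ^ 2) := by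
  induction U using Finset.induction_on generalizing f with
  | empty => simp [bexp_empty]
  | insert w U hw ih =>
    set f' : Finset V → ℝ := fun S => f (insert w S)
    have hq : 0 ≤ 1 - p := by linarith
    have H0 := mul_le_mul_of_nonneg_left (ih (f := f)) hq
    have H1 := mul_le_mul_of_nonneg_left (ih (f := f')) h0
    have hD := bexp_sq_le (f := fun S => f' S + (-1) * f S) (U := U) h0 h1
    rw [bexp_add, bexp_const_mul] at hD
    have e1 : bexp p (insert w U) (fun S => (f (insert w S) - f (S.erase w)) ^ 2) =
        bexp p U (fun S => (f' S + (-1) * f S) ^ 2) := by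
      have a1 : bexp p U (fun S => (f (insert w S) - f (S.erase w)) ^ 2) =
          bexp p U (fun S => (f' S + (-1) * f S) ^ 2) :=
        bexp_congr fun S hS => by rw [erase_eq_of_notMem fun h => hw (hS h)]; ring
      have a2 : bexp p U (fun S => (f (insert w S) - f ((insert w S).erase w)) ^ 2) =
          bexp p U (fun S => (f' S + (-1) * f S) ^ 2) :=
        bexp_congr fun S hS => by rw [erase_insert fun h => hw (hS h)]; ring
      simp only [bexp_insert hw, insert_idem, a1, a2]
      ring
    have e2 : ∑ v ∈ U, bexp p (insert w U) (fun S => (f (insert v S) - f (S.erase v)) ^ 2) =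
        (1 - p) * ∑ v ∈ U, bexp p U (fun S => (f (insert v S) - f (S.erase v)) ^ 2) +
          p * ∑ v ∈ U, bexp p U (fun S => (f' (insert v S) - f' (S.erase v)) ^ 2) := by
      rw [mul_sum, mul_sum, ← sum_add_distrib]
      refine sum_congr rfl fun v hv => ?_
      have hvw : v ≠ w := fun h => hw (h ▸ hv)
      simp only [bexp_insert hw, f', insert_comm v w, erase_insert_of_ne hvw.symm]
    rw [sum_insert hw, e1, e2, bexp_insert hw, bexp_insert hw (f := f)]
    change (1 - p) * _ + p * bexp p U (fun S => f' S ^ 2) - ((1 - p) * _ + p * bexp p U f') ^ 2 ≤ _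
    have hp : 0 ≤ p * p := mul_nonneg h0 h0
    have e3 : p * (1 - p) * (bexp p U f' + -1 * bexp p U f) ^ 2 ≤
        p * bexp p U (fun S => (f' S + (-1) * f S) ^ 2) := by
      have hnn := bexp_nonneg (f := fun S => (f' S + (-1) * f S) ^ 2) (U := U) h0 h1
        fun S _ => sq_nonneg _
      nlinarith [mul_le_mul_of_nonneg_left hD (mul_nonneg h0 hq), mul_nonneg hp hnn]
    nlinarith

theorem chebyshev_bprob (h0 : 0 ≤ p) (h1 : p ≤ 1) {B t : ℝ} (ht : 0 < t)
    (hB : ∀ v ∈ U, bexp p U (fun S => (f (insert v S) - f (S.erase v)) ^ 2) ≤ B) :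
    bprob p U (fun S => t ≤ |f S - bexp p U f|) ≤ p * #U * B / t ^ 2 := by
  have hes := efron_stein (f := f) (U := U) h0 h1
  have hs : ∑ v ∈ U, bexp p U (fun S => (f (insert v S) - f (S.erase v)) ^ 2) ≤ #U * B := by
    simpa using sum_le_card_nsmul U _ B hB
  have e : bexp p U (fun S => (f S - bexp p U f) ^ 2) =
      bexp p U (fun S => f S ^ 2) + (-2 * bexp p U f * bexp p U f + bexp p U f ^ 2) := by
    rw [← bexp_const_mul, ← bexp_const (p := p) (U := U) (bexp p U f ^ 2), ← bexp_add, ← bexp_add]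
    exact bexp_congr fun S _ => by ring
  rw [le_div_iff₀ (by positivity), mul_comm, bprob, ← bexp_const_mul]
  calc _ ≤ bexp p U (fun S => (f S - bexp p U f) ^ 2) := by
        refine bexp_mono h0 h1 fun S _ => ?_
        split_ifs with h
        · rw [mul_one, ← sq_abs (f S - _)]
          exact pow_le_pow_left₀ ht.le h 2
        · rw [mul_zero]; positivity
    _ ≤ p * (#U * B) := by
        rw [e]; nlinarith [mul_le_mul_of_nonneg_left hs h0]
    _ = _ := by ring

end RandomSubset

section Cluster

variable {V : Type*} [Fintype V] (G : SimpleGraph V)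

/-- The vertices that can be reached from `D` by paths of `G` all of whose later vertices lie
in `X`. -/
noncomputable def cluster (D X : Finset V) : Finset V :=
  open Classical in
  univ.filter fun v => ∃ u ∈ D, Relation.ReflTransGen (fun a b => G.Adj a b ∧ b ∈ X) u v

variable {G} {D D' X X' C S : Finset V} {u v w a b : V}

theorem mem_cluster :
    v ∈ cluster G D X ↔ ∃ u ∈ D, Relation.ReflTransGen (fun a b => G.Adj a b ∧ b ∈ X) u v := by
  simp [cluster]

theorem subset_cluster : D ⊆ cluster G D X := fun u hu => mem_cluster.2 ⟨u, hu, .refl⟩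

theorem self_mem_cluster : u ∈ cluster G {u} X := subset_cluster (mem_singleton_self u)

theorem cluster_step (ha : a ∈ cluster G D X) (hab : G.Adj a b) (hb : b ∈ X) :
    b ∈ cluster G D X := by
  obtain ⟨u, hu, h⟩ := mem_cluster.1 ha
  exact mem_cluster.2 ⟨u, hu, h.tail ⟨hab, hb⟩⟩

theorem cluster_subset (hD : D ⊆ C) (hC : ∀ a ∈ C, ∀ b ∈ X, G.Adj a b → b ∈ C) :
    cluster G D X ⊆ C := by
  intro v hv
  obtain ⟨u, hu, h⟩ := mem_cluster.1 hv
  induction h with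
  | refl => exact hD hu
  | tail h1 h2 ih => exact hC _ (ih (mem_cluster.2 ⟨u, hu, h1⟩)) _ h2.2 h2.1

theorem cluster_mono (hD : D ⊆ D') (hX : X ⊆ X') : cluster G D X ⊆ cluster G D' X' :=
  cluster_subset (hD.trans subset_cluster) fun _ ha _ hb hab => cluster_step ha hab (hX hb)

theorem cluster_subset_cluster (h : D ⊆ cluster G D' X) : cluster G D X ⊆ cluster G D' X :=
  cluster_subset h fun _ ha _ hb hab => cluster_step ha hab hb

theorem cluster_singleton_subset (h : v ∈ cluster G D X) : cluster G {v} X ⊆ cluster G D X :=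
  cluster_subset_cluster (singleton_subset_iff.2 h)

theorem cluster_eq_self (h : ∀ a ∈ D, ∀ b ∈ X, G.Adj a b → b ∈ D) : cluster G D X = D :=
  (cluster_subset subset_rfl h).antisymm subset_cluster

theorem cluster_subset_of_mem (hu : u ∈ S) : cluster G {u} S ⊆ S :=
  cluster_subset (singleton_subset_iff.2 hu) fun _ _ _ hb _ => hb

theorem cluster_symm (hu : u ∈ S) (hv : v ∈ cluster G {u} S) : u ∈ cluster G {v} S := by
  classical
  have : cluster G {u} S ⊆ S.filter fun b => u ∈ cluster G {b} S := by
    refine cluster_subset (singleton_subset_iff.2 (mem_filter.2 ⟨hu, self_mem_cluster⟩)) ?_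
    intro a ha b hb hab
    obtain ⟨haS, ha⟩ := mem_filter.1 ha
    exact mem_filter.2 ⟨hb, cluster_singleton_subset
      (cluster_step self_mem_cluster hab.symm haS) ha⟩
  exact (mem_filter.1 (this hv)).2

theorem cluster_eq_of_mem (hu : u ∈ S) (hv : v ∈ cluster G {u} S) :
    cluster G {v} S = cluster G {u} S :=
  (cluster_singleton_subset hv).antisymm (cluster_singleton_subset (cluster_symm hu hv))

variable [DecidableEq V]

theorem cluster_insert (h : w ∈ cluster G D X) : cluster G (insert w D) X = cluster G D X :=
  (cluster_subset_cluster (insert_subset h subset_cluster)).antisymm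
    (cluster_mono (subset_insert _ _) subset_rfl)

theorem cluster_erase (h : w ∈ D) : cluster G D (X.erase w) = cluster G D X := by
  refine (cluster_mono subset_rfl (erase_subset _ _)).antisymm
    (cluster_subset subset_cluster fun a ha b hb hab => ?_)
  by_cases hbw : b = w
  · exact subset_cluster (hbw ▸ h)
  · exact cluster_step ha hab (mem_erase.2 ⟨hbw, hb⟩)

end Cluster

section Probability

variable {V : Type*} {p : ℝ} {U : Finset V} {P Q : Finset V → Prop}

theorem bprob_mono (h0 : 0 ≤ p) (h1 : p ≤ 1) (h : ∀ S ⊆ U, P S → Q S) :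
    bprob p U P ≤ bprob p U Q :=
  bexp_mono h0 h1 fun S hS => by
    by_cases hP : P S
    · simp [hP, h S hS hP]
    · simp only [hP, if_false]
      split_ifs <;> norm_num

theorem bprob_le_one [DecidableEq V] (h0 : 0 ≤ p) (h1 : p ≤ 1) : bprob p U P ≤ 1 := by
  rw [← bexp_const (p := p) (U := U) 1]
  exact bexp_mono h0 h1 fun S _ => by split_ifs <;> norm_num

theorem bprob_eq_one [DecidableEq V] (h : ∀ S ⊆ U, P S) : bprob p U P = 1 := by
  exact (bexp_congr fun S hS => if_pos (h S hS)).trans (bexp_const 1)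

theorem bprob_not [DecidableEq V] : bprob p U (fun S => ¬ P S) = 1 - bprob p U P := by
  have : bprob p U (fun S => ¬ P S) + bprob p U P = 1 := by
    rw [bprob, bprob, ← bexp_add]
    refine (bexp_congr (g := fun _ => 1) fun S _ => ?_).trans (bexp_const 1)
    by_cases h : P S <;> simp [h]
  linarith

theorem bprob_cluster_eq_zero [Fintype V] [DecidableEq V] {G : SimpleGraph V} {D T : Finset V}
    {K : ℕ} (hK : K ≤ #D) :
    bprob p univ (fun S => #(cluster G D (S \ T)) < K) = 0 := by
  refine (bexp_congr fun S _ => if_neg ?_).trans (bexp_const 0)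
  exact not_lt.2 (hK.trans (card_le_card subset_cluster))

end Probability

section Exploration

variable {V : Type*} [Fintype V] [DecidableEq V] (G : SimpleGraph V) [DecidableRel G.Adj]

/-- The vertices adjacent to some vertex of `D`. -/
def nbhd (D : Finset V) : Finset V := D.biUnion fun v => G.neighborFinset v

/-- The vertices with fewer than `m` neighbours outside the neighbourhood of `D`. -/
def overlapping (m : ℕ) (D : Finset V) : Finset V :=
  univ.filter fun w => #(G.neighborFinset w \ nbhd G D) < m

variable {G} {D T S X : Finset V} {w : V} {K d m : ℕ} {p s M : ℝ}

theorem mem_nbhd {v : V} : v ∈ nbhd G D ↔ ∃ u ∈ D, G.Adj u v := by simp [nbhd]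

theorem nbhd_insert : nbhd G (insert w D) = nbhd G D ∪ G.neighborFinset w := by
  rw [nbhd, biUnion_insert, union_comm, nbhd]

theorem overlapping_mono {D' : Finset V} (h : D ⊆ D') :
    overlapping G m D ⊆ overlapping G m D' := by
  intro w hw
  simp only [overlapping, mem_filter, mem_univ, true_and] at hw ⊢
  exact (card_le_card (sdiff_subset_sdiff subset_rfl (biUnion_subset_biUnion_of_subset_left _ h))
    ).trans_lt hw

/-- Revealing the state of one vertex of the boundary. -/
theorem bprob_cluster_split (K : ℕ) (hw : w ∈ nbhd G D) (hT : w ∉ T) :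
    bprob p univ (fun S => #(cluster G D (S \ T)) < K) =
      p * bprob p univ (fun S => #(cluster G (insert w D) (S \ insert w T)) < K) +
      (1 - p) * bprob p univ (fun S => #(cluster G D (S \ insert w T)) < K) := by
  obtain ⟨u, hu, huw⟩ := mem_nbhd.1 hw
  rw [bprob, bexp_split (mem_univ w), bprob, bprob]
  congr 3
  · funext S
    have h1 : w ∈ insert w S \ T := mem_sdiff.2 ⟨mem_insert_self _ _, hT⟩
    have h2 : S \ insert w T = (insert w S \ T).erase w := by ext x; simp; tauto
    rw [h2, cluster_erase (mem_insert_self _ _),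
      cluster_insert (cluster_step (subset_cluster hu) huw h1)]
  · funext S
    have h2 : S \ insert w T = S.erase w \ T := by ext x; simp; tauto
    rw [h2]

theorem card_boundary_insert (hTN : T ⊆ nbhd G D) (hw : w ∈ nbhd G D \ T) :
    #(nbhd G (insert w D) \ insert w T) + 1 =
      #(nbhd G D \ T) + #(G.neighborFinset w \ nbhd G D) := by
  have e : nbhd G (insert w D) \ insert w T =
      (nbhd G D \ T).erase w ∪ (G.neighborFinset w \ nbhd G D) := by
    rw [nbhd_insert]
    ext x
    have h1 := @hTN x
    have h2 := (mem_sdiff.1 hw).1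
    by_cases hx : x = w
    · subst hx; simp [h2]
    · simp only [mem_sdiff, mem_union, mem_insert, mem_erase, hx, false_or, not_false_iff, ne_eq,
        true_and]
      tauto
  rw [e, card_union_of_disjoint, add_right_comm, card_erase_add_one hw]
  refine disjoint_left.2 fun x hx hx' => (mem_sdiff.1 hx').2 ?_
  exact (mem_sdiff.1 (mem_of_mem_erase hx)).1

theorem card_insert_inter_overlapping (hT : w ∉ T) :
    (#(insert w T ∩ overlapping G m D) : ℝ) =
      #(T ∩ overlapping G m D) + if w ∈ overlapping G m D then 1 else 0 := by
  split_ifs with h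
  · rw [insert_inter_of_mem h, card_insert_of_notMem fun h => hT (mem_inter.1 h).1]
    push_cast; ring
  · rw [insert_inter_of_notMem h, add_zero]

theorem bprob_cluster_eq_one (hK : #D < K) (h : nbhd G D \ T = ∅) :
    bprob p univ (fun S => #(cluster G D (S \ T)) < K) = 1 := by
  refine bprob_eq_one fun S _ => ?_
  rwa [cluster_eq_self]
  intro a ha b hb hab
  exact absurd (sdiff_eq_empty_iff_subset.1 h (mem_nbhd.2 ⟨a, ha, hab⟩)) (mem_sdiff.1 hb).2

theorem bprob_cluster_le (h0 : 0 ≤ p) (h1 : p ≤ 1) (hs0 : 0 ≤ s) (hs1 : s ≤ 1)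
    (hs : p * s ^ m + (1 - p) ≤ s) (hM : ∀ D, #D < K → (#(overlapping G m D) : ℝ) ≤ M)
    (hDT : D ⊆ T) (hTN : T ⊆ nbhd G D) (hK : #D < K) :
    bprob p univ (fun S => #(cluster G D (S \ T)) < K) ≤
      s ^ #(nbhd G D \ T) + p * (M - #(T ∩ overlapping G m D)) := by
  induction hk : #Tᶜ using Nat.strong_induction_on generalizing D T with
  | _ k ih =>
  have hMT : ∀ T' : Finset V, 0 ≤ p * (M - #(T' ∩ overlapping G m D)) := fun T' => by
    refine mul_nonneg h0 (sub_nonneg.2 (le_trans ?_ (hM D hK)))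
    exact_mod_cast card_le_card inter_subset_right
  rcases (nbhd G D \ T).eq_empty_or_nonempty with he | ⟨w, hw⟩
  · rw [he, card_empty, pow_zero]
    linarith [bprob_le_one (P := fun S => #(cluster G D (S \ T)) < K) (U := univ) h0 h1, hMT T]
  obtain ⟨hwN, hwT⟩ := mem_sdiff.1 hw
  have hlt : #(insert w T)ᶜ < k :=
    hk ▸ card_lt_card (compl_ssubset_compl.2 (ssubset_insert hwT))
  have hTN' : insert w T ⊆ nbhd G D := insert_subset hwN hTN
  have hb := card_boundary_insert hTN hw
  have hb' : #(nbhd G D \ insert w T) + 1 = #(nbhd G D \ T) := by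
    rw [← card_erase_add_one hw]
    congr 2
    ext x; simp; tauto
  set Q := #(nbhd G D \ insert w T)
  set R := #(nbhd G (insert w D) \ insert w T)
  set c := #(G.neighborFinset w \ nbhd G D)
  have hR : R = Q + c := by omega
  have g0 := ih _ hlt (D := D) (T := insert w T) (hDT.trans (subset_insert _ _)) hTN' hK rfl
  have g1 : bprob p univ (fun S => #(cluster G (insert w D) (S \ insert w T)) < K) ≤
      s ^ R + p * (M - #(insert w T ∩ overlapping G m D)) := by
    rcases lt_or_ge #(insert w D) K with h | h
    · refine (ih _ hlt (D := insert w D) (T := insert w T) (insert_subset_insert _ hDT)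
        (hTN'.trans (nbhd_insert (G := G) ▸ subset_union_left)) h rfl).trans ?_
      gcongr
      exact overlapping_mono (subset_insert _ _)
    · rw [bprob_cluster_eq_zero h]
      exact add_nonneg (pow_nonneg hs0 _) (hMT _)
  rw [bprob_cluster_split K hwN hwT, ← hb']
  have hq : 0 ≤ 1 - p := by linarith
  have hsR : s ^ R ≤ s ^ Q * s ^ m + if w ∈ overlapping G m D then 1 else 0 := by
    split_ifs with h
    · exact (pow_le_one₀ hs0 hs1).trans
        (by linarith [mul_nonneg (pow_nonneg hs0 Q) (pow_nonneg hs0 m)])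
    · have : m ≤ c := by simpa [overlapping, c] using h
      rw [hR, add_zero, ← pow_add]
      exact pow_le_pow_of_le_one hs0 hs1 (by omega)
  rw [card_insert_inter_overlapping hwT] at g0 g1
  have f0 := mul_le_mul_of_nonneg_left g0 hq
  have f1 := mul_le_mul_of_nonneg_left g1 h0
  have f2 := mul_le_mul_of_nonneg_left hsR h0
  have f3 := mul_le_mul_of_nonneg_left hs (pow_nonneg hs0 Q)
  rw [pow_succ]
  linarith

theorem le_bprob_cluster {s' r : ℝ} (h0 : 0 ≤ p) (h1 : p ≤ 1) (hs0 : 0 ≤ s) (hss : s ≤ s')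
    (hs1 : s' ≤ 1) (hr0 : 0 ≤ r) (hr1 : r ≤ 1) (hd : ∀ v, G.degree v ≤ d)
    (hs : s ≤ p * s ^ d + (1 - p)) (hs' : p * s' ^ m + (1 - p) * r ≤ s' * r)
    (hM : ∀ D, #D < K → (#(overlapping G m D) : ℝ) ≤ M)
    (hDT : D ⊆ T) (hTN : T ⊆ nbhd G D) (hK : #D < K) :
    s ^ #(nbhd G D \ T) - s' ^ #(nbhd G D \ T) * r ^ (K - #D) -
        p * (M - #(T ∩ overlapping G m D)) ≤
      bprob p univ (fun S => #(cluster G D (S \ T)) < K) := by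
  have hs'0 : 0 ≤ s' := hs0.trans hss
  induction hk : #Tᶜ using Nat.strong_induction_on generalizing D T with
  | _ k ih =>
  have hMT : ∀ T' : Finset V, 0 ≤ p * (M - #(T' ∩ overlapping G m D)) := fun T' => by
    refine mul_nonneg h0 (sub_nonneg.2 (le_trans ?_ (hM D hK)))
    exact_mod_cast card_le_card inter_subset_right
  rcases (nbhd G D \ T).eq_empty_or_nonempty with he | ⟨w, hw⟩
  · rw [bprob_cluster_eq_one hK he, he, card_empty, pow_zero, pow_zero]
    linarith [hMT T, pow_nonneg hr0 (K - #D)]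
  obtain ⟨hwN, hwT⟩ := mem_sdiff.1 hw
  have hlt : #(insert w T)ᶜ < k :=
    hk ▸ card_lt_card (compl_ssubset_compl.2 (ssubset_insert hwT))
  have hTN' : insert w T ⊆ nbhd G D := insert_subset hwN hTN
  have hb := card_boundary_insert hTN hw
  have hb' : #(nbhd G D \ insert w T) + 1 = #(nbhd G D \ T) := by
    rw [← card_erase_add_one hw]
    congr 2
    ext x; simp; tauto
  have hDw : #(insert w D) = #D + 1 := card_insert_of_notMem fun h => hwT (hDT h)
  have hcd : #(G.neighborFinset w \ nbhd G D) ≤ d :=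
    (card_le_card sdiff_subset).trans (by simpa using hd w)
  set Q := #(nbhd G D \ insert w T)
  set R := #(nbhd G (insert w D) \ insert w T)
  set c := #(G.neighborFinset w \ nbhd G D)
  have hR : R = Q + c := by omega
  have g0 := ih _ hlt (D := D) (T := insert w T) (hDT.trans (subset_insert _ _)) hTN' hK rfl
  obtain ⟨j, hj⟩ : ∃ j, K - #D = j + 1 := ⟨K - #D - 1, by omega⟩
  have g1 : s ^ R - s' ^ R * r ^ j - p * (M - #(insert w T ∩ overlapping G m D)) ≤
      bprob p univ (fun S => #(cluster G (insert w D) (S \ insert w T)) < K) := by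
    rcases lt_or_ge #(insert w D) K with h | h
    · refine le_trans ?_ (ih _ hlt (D := insert w D) (T := insert w T)
        (insert_subset_insert _ hDT)
        (hTN'.trans (nbhd_insert (G := G) ▸ subset_union_left)) h rfl)
      rw [show K - #(insert w D) = j by omega]
      gcongr
      exact overlapping_mono (subset_insert _ _)
    · rw [bprob_cluster_eq_zero h, show j = 0 by omega]
      linarith [pow_le_pow_left₀ hs0 hss R, hMT (insert w T)]
  rw [bprob_cluster_split K hwN hwT, ← hb', hj]
  rw [hj] at g0
  have hq : 0 ≤ 1 - p := by linarith
  have hsR : s' ^ R * r ^ j ≤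
      s' ^ Q * s' ^ m * r ^ j + if w ∈ overlapping G m D then 1 else 0 := by
    split_ifs with h
    · have := mul_le_one₀ (pow_le_one₀ hs'0 hs1 (n := R)) (pow_nonneg hr0 j) (pow_le_one₀ hr0 hr1)
      have : 0 ≤ s' ^ Q * s' ^ m * r ^ j := by positivity
      linarith
    · have : m ≤ c := by simpa [overlapping, c] using h
      rw [hR, add_zero, ← pow_add]
      exact mul_le_mul_of_nonneg_right (pow_le_pow_of_le_one hs'0 hs1 (by omega))
        (pow_nonneg hr0 j)
  have hsR' : s ^ Q * s ^ d ≤ s ^ R := by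
    rw [hR, ← pow_add]
    exact pow_le_pow_of_le_one hs0 (hss.trans hs1) (by omega)
  rw [card_insert_inter_overlapping hwT] at g0 g1
  have f0 := mul_le_mul_of_nonneg_left g0 hq
  have f1 := mul_le_mul_of_nonneg_left g1 h0
  have f2 := mul_le_mul_of_nonneg_left hsR h0
  have f3 := mul_le_mul_of_nonneg_left hs (pow_nonneg hs0 Q)
  have f4 := mul_le_mul_of_nonneg_left hsR' h0
  have f5 := mul_le_mul_of_nonneg_left hs' (mul_nonneg (pow_nonneg hs'0 Q) (pow_nonneg hr0 j))
  simp only [pow_succ] at f0 ⊢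
  linarith

end Exploration

section LargeComponents

variable {V : Type*} [Fintype V] (G : SimpleGraph V)

/-- The vertices of `S` whose component in the subgraph induced on `S` has at least `K`
vertices. -/
noncomputable def bigVerts (K : ℕ) (S : Finset V) : Finset V :=
  S.filter fun u => K ≤ #(cluster G {u} S)

variable {G} {S S' : Finset V} {u v : V} {K : ℕ} {p : ℝ}

theorem mem_bigVerts : u ∈ bigVerts G K S ↔ u ∈ S ∧ K ≤ #(cluster G {u} S) := by
  simp [bigVerts]

theorem bigVerts_mono (h : S ⊆ S') : bigVerts G K S ⊆ bigVerts G K S' := fun u hu => by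
  rw [mem_bigVerts] at hu ⊢
  exact ⟨h hu.1, hu.2.trans (card_le_card (cluster_mono subset_rfl h))⟩

/-- The probability that both ends of an edge survive in a large component. -/
theorem bexp_edge [DecidableEq V] (huv : G.Adj u v) (K : ℕ) :
    bexp p univ (fun S => if u ∈ S ∧ v ∈ S ∧ K ≤ #(cluster G {u} S) then 1 else 0) =
      p ^ 2 * (1 - bprob p univ (fun S => #(cluster G {u, v} (S \ {u, v})) < K)) := by
  have hne : u ≠ v := huv.ne
  rw [bexp_split (mem_univ u), bexp_split (mem_univ v)]
  simp only [notMem_erase, false_and, if_false, bexp_const, mul_zero, add_zero]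
  have z : ∀ S : Finset V, v ∉ insert u (S.erase v) := fun S => by simp [hne.symm]
  simp only [z, false_and, and_false, if_false, bexp_const, mul_zero, add_zero]
  rw [← bprob_not, bprob, ← mul_assoc, sq]
  congr 2
  funext S
  have e : cluster G {u} (insert u (insert v S)) = cluster G {u, v} (S \ {u, v}) := by
    have e1 : S \ {u, v} = ((insert u (insert v S)).erase u).erase v := by
      ext x; simp; tauto
    rw [e1, cluster_erase (by simp), cluster_erase (by simp), pair_comm, cluster_insert]
    exact cluster_step self_mem_cluster huv (by simp)
  simp [e]

theorem insert_erase_self {α : Type*} [DecidableEq α] {S : Finset α} {v : α} :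
    insert v (S.erase v) = insert v S := by
  ext; simp; tauto

end LargeComponents

section Concentration

variable {V : Type*} [Fintype V] [DecidableEq V] (G : SimpleGraph V) [DecidableRel G.Adj]

/-- The number of neighbours of `v` in `S`. -/
def degIn (S : Finset V) (v : V) : ℕ := #(S ∩ G.neighborFinset v)

/-- The sum of the degrees, truncated at `H`, of the vertices in components with at least `K`
vertices. -/
noncomputable def bigDegreeSum (K H : ℕ) (S : Finset V) : ℕ :=
  ∑ u ∈ bigVerts G K S, min (degIn G S u) H

variable {G} {S S' : Finset V} {u v w : V} {K H d : ℕ} {p : ℝ}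

theorem degIn_mono (h : S ⊆ S') : degIn G S v ≤ degIn G S' v :=
  card_le_card (inter_subset_inter_right h)

theorem bigDegreeSum_mono (h : S ⊆ S') : bigDegreeSum G K H S ≤ bigDegreeSum G K H S' :=
  (sum_le_sum fun _ _ => min_le_min_right _ (degIn_mono h)).trans
    (sum_le_sum_of_subset (bigVerts_mono h))

theorem degIn_insert (hv : v ∉ S) :
    degIn G (insert v S) u = degIn G S u + if G.Adj v u then 1 else 0 := by
  rw [degIn, degIn]
  split_ifs with h
  · rw [insert_inter_of_mem (by simpa using h.symm),
      card_insert_of_notMem fun h => hv (mem_inter.1 h).1]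
  · rw [insert_inter_of_notMem (by simpa using fun h' : G.Adj u v => h h'.symm), add_zero]

theorem degIn_insert_self : degIn G (insert v S) v = degIn G S v := by
  rw [degIn, insert_inter_of_notMem (by simp), degIn]

theorem degIn_le_card_cluster : degIn G S u ≤ #(cluster G {u} S) :=
  card_le_card fun w hw => by
    simp only [mem_inter, SimpleGraph.mem_neighborFinset] at hw
    exact cluster_step self_mem_cluster hw.2 hw.1

/-- Inserting `v` only changes the components of the neighbours of `v`. -/
theorem exists_mem_cluster_of_lt (hu : u ∈ S)
    (h : #(cluster G {u} S) < #(cluster G {u} (insert v S))) :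
    ∃ w ∈ S ∩ G.neighborFinset v, u ∈ cluster G {w} S ∧ cluster G {w} S = cluster G {u} S := by
  by_contra! hc
  refine h.not_ge (card_le_card (cluster_subset subset_cluster fun a ha b hb hab => ?_))
  rcases mem_insert.1 hb with rfl | hb
  · have haS := cluster_subset_of_mem hu ha
    have := cluster_eq_of_mem hu ha
    exact absurd this (hc a (by simp [haS, hab.symm]) (this ▸ self_mem_cluster))
  · exact cluster_step ha hab hb

theorem bigDegreeSum_insert_le (hv : v ∉ S) :
    bigDegreeSum G K H (insert v S) ≤ bigDegreeSum G K H S + degIn G S v * (K ^ 2 + 2) := by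
  have key : ∀ u ∈ S, (if K ≤ #(cluster G {u} (insert v S)) then min (degIn G (insert v S) u) H
        else 0) ≤
      (if K ≤ #(cluster G {u} S) then min (degIn G S u) H else 0) +
        (if u ∈ G.neighborFinset v then 1 else 0) +
        ∑ w ∈ S ∩ G.neighborFinset v,
          if u ∈ cluster G {w} S ∧ #(cluster G {w} S) < K then K else 0 := by
    intro u hu
    have hdeg := degIn_insert (G := G) (u := u) hv
    by_cases h1 : K ≤ #(cluster G {u} (insert v S))
    swap
    · simp [h1]
    rw [if_pos h1, hdeg]
    by_cases h0 : K ≤ #(cluster G {u} S)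
    · rw [if_pos h0]
      refine le_trans ?_ (Nat.le_add_right _ _)
      simp only [SimpleGraph.mem_neighborFinset]
      omega
    · rw [if_neg h0]
      push Not at h0
      obtain ⟨w, hw, huw, e⟩ := exists_mem_cluster_of_lt hu (h0.trans_le h1)
      have hle : K ≤ ∑ w ∈ S ∩ G.neighborFinset v,
          if u ∈ cluster G {w} S ∧ #(cluster G {w} S) < K then K else 0 := by
        refine le_trans (le_of_eq ?_) (single_le_sum (fun _ _ => Nat.zero_le _) hw)
        rw [if_pos ⟨huw, e ▸ h0⟩]
      have := degIn_le_card_cluster (G := G) (S := S) (u := u)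
      refine le_trans ?_ (le_add_left hle)
      split_ifs <;> omega
  have hs := sum_le_sum key
  rw [sum_add_distrib, sum_add_distrib, sum_comm, ← sum_filter, ← sum_filter] at hs
  rw [bigDegreeSum, bigVerts, sum_filter, sum_insert hv, bigDegreeSum, bigVerts, ← sum_filter]
  have e1 : (∑ u ∈ S, if u ∈ G.neighborFinset v then 1 else 0) = degIn G S v := by
    rw [← card_filter, filter_mem_eq_inter, degIn]
  have e2 : ∑ w ∈ S ∩ G.neighborFinset v, ∑ u ∈ S,
      (if u ∈ cluster G {w} S ∧ #(cluster G {w} S) < K then K else 0) ≤ degIn G S v * K ^ 2 := by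
    rw [degIn, ← smul_eq_mul]
    refine sum_le_card_nsmul _ _ _ fun w _ => ?_
    rw [← sum_filter, sum_const, smul_eq_mul, pow_two]
    refine Nat.mul_le_mul_right _ ?_
    by_cases hK : #(cluster G {w} S) < K
    · exact (card_le_card fun x hx => (mem_filter.1 hx).2.1).trans hK.le
    · simp [hK]
  have e3 : (if K ≤ #(cluster G {v} (insert v S)) then min (degIn G (insert v S) v) H else 0) ≤
      degIn G S v := by
    rw [degIn_insert_self]
    split_ifs <;> omega
  rw [e1] at hs
  linarith

theorem bexp_degIn (h : G.IsRegularOfDegree d) :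
    bexp p univ (fun S => (degIn G S v : ℝ)) = p * d := by
  have := bexp_card_inter (p := p) (U := univ) (G.neighborFinset v)
  rwa [univ_inter, SimpleGraph.card_neighborFinset_eq_degree, h v] at this

theorem bexp_degIn_sq_le (h0 : 0 ≤ p) (h : G.IsRegularOfDegree d) :
    bexp p univ (fun S => (degIn G S v : ℝ) ^ 2) ≤ p * d + (p * d) ^ 2 := by
  have := bexp_card_inter_sq_le (U := univ) h0 (G.neighborFinset v)
  rwa [SimpleGraph.card_neighborFinset_eq_degree, h v] at this

theorem bprob_bigDegreeSum (h0 : 0 ≤ p) (h1 : p ≤ 1) (h : G.IsRegularOfDegree d) {t : ℝ}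
    (ht : 0 < t) :
    bprob p univ (fun S => t ≤ |(bigDegreeSum G K H S : ℝ) -
        bexp p univ (fun S => (bigDegreeSum G K H S : ℝ))|) ≤
      p * Fintype.card V * ((K ^ 2 + 2) ^ 2 * (p * d + (p * d) ^ 2)) / t ^ 2 := by
  refine chebyshev_bprob h0 h1 ht fun v _ => ?_
  calc _ ≤ bexp p univ (fun S => ((K : ℝ) ^ 2 + 2) ^ 2 * (degIn G S v : ℝ) ^ 2) := by
        refine bexp_mono h0 h1 fun S _ => ?_
        have a1 : bigDegreeSum G K H (S.erase v) ≤ bigDegreeSum G K H (insert v S) :=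
          bigDegreeSum_mono ((erase_subset _ _).trans (subset_insert _ _))
        have a2 := bigDegreeSum_insert_le (G := G) (K := K) (H := H) (notMem_erase v S)
        rw [insert_erase_self] at a2
        have a3 : degIn G (S.erase v) v ≤ degIn G S v := degIn_mono (erase_subset _ _)
        have a4 : bigDegreeSum G K H (insert v S) ≤
            bigDegreeSum G K H (S.erase v) + degIn G S v * (K ^ 2 + 2) :=
          a2.trans (by gcongr)
        have a1' : (bigDegreeSum G K H (S.erase v) : ℝ) ≤ bigDegreeSum G K H (insert v S) := by
          exact_mod_cast a1
        have a4' : (bigDegreeSum G K H (insert v S) : ℝ) ≤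
            bigDegreeSum G K H (S.erase v) + degIn G S v * (K ^ 2 + 2) := by
          exact_mod_cast a4
        rw [← mul_pow]
        exact pow_le_pow_left₀ (by linarith) (by linarith) 2
    _ ≤ _ := by
        rw [bexp_const_mul]
        exact mul_le_mul_of_nonneg_left (bexp_degIn_sq_le h0 h) (by positivity)

theorem bexp_sum_degIn_sq_le (h0 : 0 ≤ p) (h : G.IsRegularOfDegree d) :
    bexp p univ (fun S => ∑ w, (degIn G S w : ℝ) ^ 2) ≤
      Fintype.card V * (p * d + (p * d) ^ 2) := by
  rw [bexp_sum]
  exact (sum_le_card_nsmul univ _ _ fun w _ => bexp_degIn_sq_le (v := w) h0 h).trans_eq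
    (by rw [nsmul_eq_mul, card_univ])

theorem bprob_sum_degIn_sq (h0 : 0 ≤ p) (h1 : p ≤ 1) (h : G.IsRegularOfDegree d) {t : ℝ}
    (ht : 0 < t) :
    bprob p univ (fun S => t ≤ |∑ w, (degIn G S w : ℝ) ^ 2 -
        bexp p univ (fun S => ∑ w, (degIn G S w : ℝ) ^ 2)|) ≤
      p * Fintype.card V * (d ^ 2 * (8 * (p * d) + 4 * (p * d) ^ 2 + 1)) / t ^ 2 := by
  refine chebyshev_bprob h0 h1 ht fun v _ => ?_
  calc _ ≤ bexp p univ (fun S => d * ∑ w ∈ G.neighborFinset v,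
          (4 * (degIn G S w : ℝ) ^ 2 + (4 * (degIn G S w : ℝ) + 1))) := by
        refine bexp_mono h0 h1 fun S _ => ?_
        have e : ∑ w, (degIn G (insert v S) w : ℝ) ^ 2 - ∑ w, (degIn G (S.erase v) w : ℝ) ^ 2 =
            ∑ w ∈ G.neighborFinset v, (2 * (degIn G (S.erase v) w : ℝ) + 1) := by
          rw [← sum_sub_distrib, SimpleGraph.neighborFinset_eq_filter, sum_filter]
          refine sum_congr rfl fun w _ => ?_
          rw [← insert_erase_self, degIn_insert (notMem_erase v S)]
          split_ifs <;> push_cast <;> ring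
        rw [e]
        have hc : (#(G.neighborFinset v) : ℝ) = d := by
          rw [SimpleGraph.card_neighborFinset_eq_degree, h v]
        refine (sq_sum_le_card_mul_sum_sq (s := G.neighborFinset v)).trans ?_
        rw [hc]
        gcongr with w
        have : (degIn G (S.erase v) w : ℝ) ≤ degIn G S w := by
          exact_mod_cast degIn_mono (erase_subset _ _)
        have h' : (0 : ℝ) ≤ degIn G (S.erase v) w := by positivity
        nlinarith
    _ ≤ _ := by
        rw [bexp_const_mul, bexp_sum, sq, mul_assoc]
        refine mul_le_mul_of_nonneg_left ?_ (by positivity)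
        have : ∀ w ∈ G.neighborFinset v, bexp p univ (fun S =>
            (4 * (degIn G S w : ℝ) ^ 2 + (4 * (degIn G S w : ℝ) + 1))) ≤
              8 * (p * d) + 4 * (p * d) ^ 2 + 1 := by
          intro w _
          rw [bexp_add, bexp_const_mul, bexp_add, bexp_const_mul, bexp_degIn h, bexp_const]
          linarith [bexp_degIn_sq_le (v := w) h0 h]
        exact (sum_le_card_nsmul _ _ _ this).trans_eq (by
          rw [nsmul_eq_mul, SimpleGraph.card_neighborFinset_eq_degree, h v])

theorem bexp_bigDegreeSum (h : G.IsRegularOfDegree d) (K : ℕ) :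
    bexp p univ (fun S => (bigDegreeSum G K d S : ℝ)) =
      ∑ u, ∑ v ∈ G.neighborFinset u,
        p ^ 2 * (1 - bprob p univ (fun S => #(cluster G {u, v} (S \ {u, v})) < K)) := by
  have e : ∀ S : Finset V, (bigDegreeSum G K d S : ℝ) = ∑ u, ∑ v ∈ G.neighborFinset u,
      if u ∈ S ∧ v ∈ S ∧ K ≤ #(cluster G {u} S) then 1 else 0 := by
    intro S
    rw [bigDegreeSum, bigVerts, sum_filter, Nat.cast_sum, ← sum_subset (subset_univ S)]
    · refine sum_congr rfl fun u hu => ?_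
      have hle : degIn G S u ≤ d :=
        (card_le_card inter_subset_right).trans_eq
          ((SimpleGraph.card_neighborFinset_eq_degree _ _).trans (h u))
      by_cases hK : K ≤ #(cluster G {u} S)
      · simp only [hu, hK, true_and, and_true, if_true]
        rw [min_eq_left hle, degIn, inter_comm, ← filter_mem_eq_inter, card_filter]
        push_cast
        rfl
      · simp [hK]
    · intro u _ hu
      simp [hu]
  simp only [e, bexp_sum]
  refine sum_congr rfl fun u _ => sum_congr rfl fun v hv => ?_
  exact bexp_edge (by simpa using hv) K

theorem bexp_sub_bigDegreeSum_le (h0 : 0 ≤ p) (h1 : p ≤ 1) (h : G.IsRegularOfDegree d)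
    (hH : 0 < H) :
    bexp p univ (fun S => (bigDegreeSum G K d S : ℝ)) ≤
      bexp p univ (fun S => (bigDegreeSum G K H S : ℝ)) +
        Fintype.card V * p * (p * d + (p * d) ^ 2) / H := by
  have key : ∀ S : Finset V, (bigDegreeSum G K d S : ℝ) ≤ bigDegreeSum G K H S +
      (H : ℝ)⁻¹ * ∑ u, if u ∈ S then (degIn G S u : ℝ) ^ 2 else 0 := by
    intro S
    rw [← sum_filter, bigDegreeSum, bigDegreeSum, mul_sum]
    have : bigVerts G K S ⊆ univ.filter (· ∈ S) := fun u hu => by simp [(mem_bigVerts.1 hu).1]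
    refine le_trans ?_ (add_le_add_right (sum_le_sum_of_subset_of_nonneg this
      fun _ _ _ => by positivity) _)
    push_cast
    rw [← sum_add_distrib]
    refine sum_le_sum fun u _ => (min_le_left _ _).trans ?_
    have hH' : (0 : ℝ) < H := by exact_mod_cast hH
    rcases le_total (degIn G S u : ℝ) H with hle | hle
    · rw [min_eq_left hle]
      linarith [show 0 ≤ (H : ℝ)⁻¹ * (degIn G S u : ℝ) ^ 2 by positivity]
    · rw [min_eq_right hle, inv_mul_eq_div]
      have : (degIn G S u : ℝ) ≤ (degIn G S u : ℝ) ^ 2 / H := by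
        rw [le_div_iff₀ hH', sq]
        gcongr
      linarith
  refine (bexp_mono h0 h1 fun S _ => key S).trans ?_
  rw [bexp_add, bexp_const_mul, bexp_sum, div_eq_inv_mul]
  gcongr
  have : ∀ u ∈ (univ : Finset V),
      bexp p univ (fun S => if u ∈ S then (degIn G S u : ℝ) ^ 2 else 0) ≤
        p * (p * d + (p * d) ^ 2) := by
    intro u _
    rw [bexp_split (mem_univ u)]
    simp only [mem_insert_self, if_true, notMem_erase, if_false, bexp_const, mul_zero, add_zero,
      degIn_insert_self]
    exact mul_le_mul_of_nonneg_left (bexp_degIn_sq_le h0 h) h0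
  exact (sum_le_card_nsmul _ _ _ this).trans_eq (by rw [nsmul_eq_mul, card_univ]; ring)

end Concentration

section Spectral

open Matrix

/-- All sets of vertices have nearly the expected number of neighbours in a set `Y`, in an `ℓ²`
sense: this is what a spectral gap yields. -/
def Pseudorandom {V : Type*} [Fintype V] [DecidableEq V] (G : SimpleGraph V) [DecidableRel G.Adj]
    (d lam : ℝ) : Prop :=
  ∀ Y : Finset V, ∑ w, ((degIn G Y w : ℝ) - d * #Y / Fintype.card V) ^ 2 ≤ lam ^ 2 * #Y

variable {n d : ℕ} {lam : ℝ} {G : SimpleGraph (Fin n)} [DecidableRel G.Adj]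

theorem sum_sq_sum_neighborFinset_le (h : IsNDLGraph n d lam G) (hlam : lam < d)
    {y : Fin n → ℝ} (hy : ∑ v, y v = 0) :
    ∑ w, (∑ v ∈ G.neighborFinset w, y v) ^ 2 ≤ lam ^ 2 * ∑ v, y v ^ 2 := by
  obtain rfl : ‹DecidableRel G.Adj› = Classical.decRel G.Adj := Subsingleton.elim _ _
  let := Classical.decRel G.Adj
  obtain ⟨hreg, i₀, hi₀, hi⟩ := h
  set hA := G.adjHermitian
  set A := G.adjMatrix ℝ with hAdef
  set b := hA.eigenvectorBasis
  have hsym : ∀ (x z : EuclideanSpace ℝ (Fin n)), inner ℝ x (WithLp.toLp 2 (A *ᵥ z.ofLp)) =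
      inner ℝ (WithLp.toLp 2 (A *ᵥ x.ofLp)) z := by
    intro x z
    simp only [EuclideanSpace.inner_eq_star_dotProduct, star_trivial]
    rw [dotProduct_mulVec, ← mulVec_transpose, G.transpose_adjMatrix, dotProduct_comm,
      dotProduct_comm]
  have hb : ∀ (i) (z : EuclideanSpace ℝ (Fin n)),
      inner ℝ (b i) (WithLp.toLp 2 (A *ᵥ z.ofLp)) = hA.eigenvalues i * inner ℝ (b i) z := by
    intro i z
    rw [hsym, hA.mulVec_eigenvectorBasis]
    rw [WithLp.toLp_smul, inner_smul_left]
    rfl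
  set e : EuclideanSpace ℝ (Fin n) := WithLp.toLp 2 fun _ => 1 with he
  have hAe : WithLp.toLp 2 (A *ᵥ e.ofLp) = (d : ℝ) • e := by
    ext w
    simp [he, hAdef, SimpleGraph.adjMatrix_mulVec_apply, hreg w]
  have horth : ∀ i, i ≠ i₀ → inner ℝ (b i) e = 0 := by
    intro i hne
    have h1 := hb i e
    rw [hAe, inner_smul_right] at h1
    have h2 : hA.eigenvalues i < d := ((le_abs_self _).trans (hi i hne)).trans_lt hlam
    by_contra h3
    exact h2.ne' (mul_right_cancel₀ h3 h1)
  set z : EuclideanSpace ℝ (Fin n) := WithLp.toLp 2 y with hz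
  have hez : inner ℝ e z = 0 := by
    simp [EuclideanSpace.inner_eq_star_dotProduct, he, hz, dotProduct, hy]
  have hz0 : inner ℝ (b i₀) z = 0 := by
    have h1 := b.sum_inner_mul_inner e z
    rw [hez, sum_eq_single i₀ (fun i _ hne => by
      rw [real_inner_comm, horth i hne, zero_mul]) (by simp)] at h1
    refine (mul_eq_zero.1 h1).resolve_left fun h2 => ?_
    have h3 := b.sum_sq_inner_right e
    rw [sum_eq_zero (fun i _ => ?_), EuclideanSpace.real_norm_sq_eq] at h3
    · simp [he] at h3
      exact i₀.pos.ne' (by exact_mod_cast h3.symm)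
    · by_cases hne : i = i₀
      · rw [hne, real_inner_comm, h2]; simp
      · rw [horth i hne]; simp
  have h1 := b.sum_sq_inner_right (WithLp.toLp 2 (A *ᵥ z.ofLp))
  have h2 := b.sum_sq_inner_right z
  rw [EuclideanSpace.real_norm_sq_eq] at h1 h2
  simp only [hAdef, SimpleGraph.adjMatrix_mulVec_apply] at h1
  rw [← h1, ← h2, mul_sum]
  refine sum_le_sum fun i _ => ?_
  rw [hb, mul_pow]
  by_cases hne : i = i₀
  · rw [hne, hz0]; simp
  · exact mul_le_mul_of_nonneg_right (sq_le_sq' (abs_le.1 (hi i hne)).1 (abs_le.1 (hi i hne)).2)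
      (sq_nonneg _)

theorem IsNDLGraph.pseudorandom (h : IsNDLGraph n d lam G) (hlam : lam < d) :
    Pseudorandom G d lam := by
  intro Y
  have hreg : G.IsRegularOfDegree d := by convert h.1
  obtain ⟨-, i₀, -⟩ := id h
  have hn : (0 : ℝ) < n := by exact_mod_cast i₀.pos
  have hY : ∑ v : Fin n, (if v ∈ Y then (1 : ℝ) else 0) = #Y := by simp
  have := sum_sq_sum_neighborFinset_le h hlam (y := fun v => (if v ∈ Y then 1 else 0) - #Y / n)
    (by rw [sum_sub_distrib, hY]; simp; field_simp; simp)
  rw [Fintype.card_fin]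
  refine (le_of_eq (sum_congr rfl fun w _ => ?_)).trans (this.trans
    (mul_le_mul_of_nonneg_left ?_ (sq_nonneg _)))
  · rw [sum_sub_distrib, ← sum_filter, filter_mem_eq_inter, inter_comm, sum_const, sum_const,
      SimpleGraph.card_neighborFinset_eq_degree, hreg w, degIn]
    simp only [nsmul_eq_mul, mul_one, mul_div_assoc]
  · have e : ∀ v : Fin n, ((if v ∈ Y then (1 : ℝ) else 0) - #Y / n) ^ 2 =
        (if v ∈ Y then (1 : ℝ) else 0) * (1 - 2 * (#Y / n)) + (#Y / n) ^ 2 := by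
      intro v; split_ifs <;> ring
    simp only [e]
    rw [sum_add_distrib, ← sum_mul, hY, sum_const, card_univ, Fintype.card_fin, nsmul_eq_mul]
    have : (#Y : ℝ) * (1 - 2 * (#Y / n)) + n * (#Y / n) ^ 2 = #Y - #Y ^ 2 / n := by
      field_simp; ring
    rw [this]
    have : (0 : ℝ) ≤ #Y ^ 2 / n := by positivity
    linarith

end Spectral

section Expansion

variable {V : Type*} [Fintype V] [DecidableEq V] {G : SimpleGraph V} [DecidableRel G.Adj]
  {d K : ℕ} {lam θ : ℝ}

theorem card_sdiff_add_degIn (Y : Finset V) (w : V) :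
    #(G.neighborFinset w \ Y) + degIn G Y w = G.degree w := by
  rw [degIn, inter_comm, card_sdiff_add_card_inter, SimpleGraph.card_neighborFinset_eq_degree]

theorem card_nbhd_le (h : G.IsRegularOfDegree d) (D : Finset V) : #(nbhd G D) ≤ #D * d :=
  card_biUnion_le_card_mul _ _ _ fun v _ => by
    rw [SimpleGraph.card_neighborFinset_eq_degree, h v]

theorem Pseudorandom.card_mul_sq_le {d : ℝ} (hP : Pseudorandom G d lam) {c : ℝ} (hc : 0 ≤ c)
    (Y W : Finset V) (hW : ∀ w ∈ W, c ≤ |(degIn G Y w : ℝ) - d * #Y / Fintype.card V|) :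
    #W * c ^ 2 ≤ lam ^ 2 * #Y := by
  refine le_trans ?_ ((sum_le_sum_of_subset_of_nonneg (subset_univ W)
    fun _ _ _ => sq_nonneg _).trans (hP Y))
  rw [← nsmul_eq_mul]
  refine card_nsmul_le_sum _ _ _ fun w hw => ?_
  rw [← sq_abs ((degIn G Y w : ℝ) - _)]
  exact pow_le_pow_left₀ hc (hW w hw) 2

/-- Few vertices send more than a fraction `θ` of their edges into the neighbourhood of a small
set. -/
theorem Pseudorandom.card_overlapping_le (hP : Pseudorandom G d lam)
    (hG : G.IsRegularOfDegree d) (hd : 0 < d) (hθ : 0 < θ) {D : Finset V} (hD : #D < K)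
    (hK : K * d ≤ θ / 2 * Fintype.card V) :
    (#(overlapping G ⌈(1 - θ) * d⌉₊ D) : ℝ) ≤ 4 * lam ^ 2 * K / (θ ^ 2 * d) := by
  have hd' : (0 : ℝ) < d := by exact_mod_cast hd
  have hV : (0 : ℝ) < Fintype.card V := by
    have hK0 : (0 : ℝ) < K := by exact_mod_cast (Nat.zero_le _).trans_lt hD
    have : 0 < θ / 2 * Fintype.card V := (by positivity : (0 : ℝ) < K * d).trans_le hK
    exact (mul_pos_iff_of_pos_left (by positivity)).1 this
  have hY : (#(nbhd G D) : ℝ) ≤ K * d := by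
    exact_mod_cast (card_nbhd_le hG D).trans (Nat.mul_le_mul_right _ hD.le)
  have h := hP.card_mul_sq_le (c := θ / 2 * d) (by positivity) (nbhd G D)
    (overlapping G ⌈(1 - θ) * d⌉₊ D) (fun w hw => ?_)
  · rw [le_div_iff₀ (by positivity)]
    have : lam ^ 2 * #(nbhd G D) ≤ lam ^ 2 * (K * d) := by gcongr
    have h' := h.trans this
    refine le_of_mul_le_mul_right (a := (d : ℝ)) ?_ hd'
    nlinarith
  · refine le_trans ?_ (le_abs_self _)
    have h1 : (#(G.neighborFinset w \ nbhd G D) : ℝ) < (1 - θ) * d :=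
      Nat.lt_ceil.1 (mem_filter.1 hw).2
    have h2 : (#(G.neighborFinset w \ nbhd G D) : ℝ) + degIn G (nbhd G D) w = d := by
      rw [← hG w]; exact_mod_cast card_sdiff_add_degIn _ _
    have h3 : (d : ℝ) * #(nbhd G D) / Fintype.card V ≤ θ / 2 * d := by
      rw [div_le_iff₀ hV]
      nlinarith
    linarith

/-- Few vertices have less than half of the expected number of neighbours in `Y`. -/
theorem Pseudorandom.card_lt_half_le {d : ℝ} (hP : Pseudorandom G d lam) (hd : 0 < d)
    {Y : Finset V} (hY : Y.Nonempty) :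
    (#{w | (degIn G Y w : ℝ) < d * #Y / (2 * Fintype.card V)} : ℝ) ≤
      4 * lam ^ 2 * Fintype.card V ^ 2 / (d ^ 2 * #Y) := by
  have hY' : (0 : ℝ) < #Y := by exact_mod_cast hY.card_pos
  have hV : (0 : ℝ) < Fintype.card V := by
    exact_mod_cast hY.card_pos.trans_le (card_le_univ Y)
  have h := hP.card_mul_sq_le (c := d * #Y / (2 * Fintype.card V)) (by positivity) Y
    {w | (degIn G Y w : ℝ) < d * #Y / (2 * Fintype.card V)} (fun w hw => ?_)
  · rw [le_div_iff₀ (by positivity)]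
    rw [div_pow, mul_div_assoc', div_le_iff₀ (by positivity)] at h
    refine le_of_mul_le_mul_right (a := (#Y : ℝ)) ?_ hY'
    nlinarith
  · have hw := (mem_filter.1 hw).2
    rw [abs_sub_comm]
    refine le_trans ?_ (le_abs_self _)
    have : d * #Y / Fintype.card V = 2 * (d * #Y / (2 * Fintype.card V)) := by
      field_simp
    linarith

/-- The second eigenvalue of a sparse regular graph is at least of order `√d`. -/
theorem Pseudorandom.le_sq [Nonempty V] (hP : Pseudorandom G d lam)
    (hG : G.IsRegularOfDegree d) (h2 : (2 : ℝ) * d ≤ Fintype.card V) : d / 4 ≤ lam ^ 2 := by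
  obtain ⟨v⟩ := ‹Nonempty V›
  have hV : (0 : ℝ) < Fintype.card V := by exact_mod_cast Fintype.card_pos_iff.2 ⟨v⟩
  have hle : (d : ℝ) / Fintype.card V ≤ 1 / 2 := by
    rw [div_le_iff₀ hV]; linarith
  have h := hP.card_mul_sq_le (c := 1 / 2) (by norm_num) {v} (G.neighborFinset v) fun w hw => ?_
  · rw [SimpleGraph.card_neighborFinset_eq_degree, hG v, card_singleton, Nat.cast_one,
      mul_one] at h
    linarith
  · have : degIn G {v} w = 1 := by
      rw [degIn, inter_eq_left.2, card_singleton]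
      simpa using ((SimpleGraph.mem_neighborFinset _ _ _).1 hw).symm
    rw [this, card_singleton]
    refine le_trans ?_ (le_abs_self _)
    simp only [Nat.cast_one, mul_one]
    linarith

end Expansion

section Survival

open Real

variable {ε x ξ y : ℝ}

theorem exp_neg_le_quadratic (hy : 0 ≤ y) : exp (-y) ≤ 1 - y + y ^ 2 / 2 := by
  rw [exp_neg, inv_le_iff_one_le_mul₀ (exp_pos y)]
  have h1 := quadratic_le_exp_of_nonneg hy
  have h2 : 0 < 1 - y + y ^ 2 / 2 := by nlinarith [sq_nonneg (y - 1)]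
  nlinarith [mul_le_mul_of_nonneg_left h1 h2.le, sq_nonneg (y ^ 2)]

theorem lt_survival (h0 : 0 < ε) (h1 : ε < 1 / 10) (hx : 0 < x)
    (h : x = (1 + ε) * (1 - exp (-x))) : 3 / 2 * ε < x := by
  have h2 := exp_neg_le_quadratic hx.le
  have h3 : (1 + ε) * (x - x ^ 2 / 2) ≤ x := by
    nth_rw 3 [h]
    exact mul_le_mul_of_nonneg_left (by linarith) (by linarith)
  have h4 : (1 + ε) * (1 - x / 2) ≤ 1 := by
    refine le_of_mul_le_mul_right (a := x) ?_ hx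
    linarith
  nlinarith

theorem survival_exp (h : x = (1 + ε) * (1 - exp (-x))) : (1 + ε) * exp (-x) = 1 + ε - x := by
  linarith

theorem le_sub_add_survival (h0 : 0 < ε) (h1 : ε < 1 / 10) (hx : x ∈ Set.Ioo (0 : ℝ) 1)
    (h : x = (1 + ε) * (1 - exp (-x))) (hξ : 0 ≤ ξ) :
    (1 + ε) * (1 - exp (-(x + ξ))) + ξ * ε / 2 ≤ x + ξ := by
  have h2 := survival_exp h
  have h3 := lt_survival h0 h1 hx.1 h
  have h4 := add_one_le_exp (-ξ)
  rw [neg_add, exp_add, mul_sub, ← mul_assoc, h2]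
  nlinarith [hx.2, mul_le_mul_of_nonneg_left h4 (show 0 ≤ 1 + ε - x by linarith [hx.2]),
    mul_le_mul_of_nonneg_left h3.le hξ]

theorem sub_survival_add_le (h0 : 0 < ε) (h1 : ε < 1 / 10) (hx : x ∈ Set.Ioo (0 : ℝ) 1)
    (h : x = (1 + ε) * (1 - exp (-x))) (hξ : 0 ≤ ξ) (hξε : ξ ≤ ε / 4) :
    x - ξ + ξ * ε / 4 ≤ (1 + ε) * (1 - exp (-(x - ξ))) := by
  have h2 := survival_exp h
  have h3 := lt_survival h0 h1 hx.1 h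
  have h4 : exp ξ ≤ 1 + ξ + ξ ^ 2 := by
    have := abs_le.1 (abs_exp_sub_one_sub_id_le (x := ξ) (by rw [abs_of_nonneg hξ]; linarith))
    linarith [this.2]
  have h5 : (0 : ℝ) ≤ 1 + ε - x := by linarith [hx.2]
  rw [neg_sub, show ξ - x = -x + ξ by ring, exp_add, mul_sub (1 + ε),
    mul_comm (exp (-x)), ← mul_assoc,
    mul_comm _ (exp ξ), mul_assoc, h2]
  nlinarith [mul_le_mul_of_nonneg_left h4 h5, mul_le_mul_of_nonneg_left h3.le hξ,
    mul_le_mul_of_nonneg_left hξε hξ, mul_nonneg (mul_nonneg hξ hξ) (show 0 ≤ x - ε by linarith)]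

theorem existsUnique_survival (h0 : 0 < ε) (h1 : ε < 1 / 10) :
    ∃! x : ℝ, x ∈ Set.Ioo (0 : ℝ) 1 ∧ x = (1 + ε) * (1 - exp (-x)) := by
  have hcont : ContinuousOn (fun y : ℝ => y - (1 + ε) * (1 - exp (-y)))
      (Set.Icc (3 / 2 * ε) 1) := by fun_prop
  have hmem : (0 : ℝ) ∈ Set.Ioo (3 / 2 * ε - (1 + ε) * (1 - exp (-(3 / 2 * ε))))
      (1 - (1 + ε) * (1 - exp (-1))) := by
    constructor
    · have := exp_neg_le_quadratic (y := 3 / 2 * ε) (by positivity)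
      have h2 : (1 + ε) * (3 / 2 * ε - (3 / 2 * ε) ^ 2 / 2) ≤
          (1 + ε) * (1 - exp (-(3 / 2 * ε))) := by
        exact mul_le_mul_of_nonneg_left (by linarith) (by linarith)
      nlinarith [mul_pos h0 h0, mul_pos (mul_pos h0 h0) (show (0 : ℝ) < 1 / 10 - ε by linarith)]
    · have := exp_neg_one_gt_d9
      nlinarith
  obtain ⟨x, hx, hx0⟩ := intermediate_value_Ioo (by linarith) hcont hmem
  have hxI : x ∈ Set.Ioo (0 : ℝ) 1 := ⟨by linarith [hx.1], hx.2⟩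
  refine ⟨x, ⟨hxI, by simpa [sub_eq_zero] using hx0⟩, ?_⟩
  have key : ∀ y z : ℝ, y ∈ Set.Ioo (0 : ℝ) 1 → y = (1 + ε) * (1 - exp (-y)) →
      z = (1 + ε) * (1 - exp (-z)) → z ≤ y := by
    intro y z hy hy' hz
    by_contra! hlt
    have := le_sub_add_survival h0 h1 hy hy' (sub_nonneg.2 hlt.le)
    rw [add_sub_cancel, ← hz] at this
    nlinarith [mul_pos (sub_pos.2 hlt) h0]
  exact fun y hy => le_antisymm (key x y hxI (by simpa [sub_eq_zero] using hx0) hy.2)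
    (key y x hy.1 hy.2 (by simpa [sub_eq_zero] using hx0))

variable {d m : ℕ} {a b p θ η r : ℝ}

/-- The exploration from above is dominated while its parameter exceeds the survival parameter. -/
theorem exp_le_step (h0 : 0 < ε) (h1 : ε < 1 / 10) (hx : x ∈ Set.Ioo (0 : ℝ) 1)
    (h : x = (1 + ε) * (1 - exp (-x))) (hξ : 0 ≤ ξ) (hξ1 : ξ ≤ 1) (hd : 0 < d)
    (hdξ : 4 ≤ ξ * ε * d) :
    exp (-(x + ξ) / d) ≤
      (1 + ε) / d * exp (-(x + ξ) / d) ^ d + (1 - (1 + ε) / d) := by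
  have hd' : (0 : ℝ) < d := by exact_mod_cast hd
  have e : exp (-(x + ξ) / d) ^ d = exp (-(x + ξ)) := by
    rw [← exp_nat_mul]; congr 1; field_simp
  rw [e]
  have h2 := le_sub_add_survival h0 h1 hx h hξ
  have h3 := exp_neg_le_quadratic (y := (x + ξ) / d) (div_nonneg (by linarith [hx.1]) hd'.le)
  rw [← neg_div] at h3
  refine h3.trans ?_
  have h4 : ((x + ξ) / d) ^ 2 / 2 ≤ ξ * ε / 2 / d := by
    rw [div_pow, div_div, div_le_div_iff₀ (by positivity) hd']
    have : (x + ξ) ^ 2 ≤ 4 := by nlinarith [hx.1, hx.2]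
    nlinarith [mul_pos hd' hd']
  have h5 : (1 + ε) / d * (1 - exp (-(x + ξ))) + ξ * ε / 2 / d ≤ (x + ξ) / d := by
    rw [div_mul_eq_mul_div, ← add_div]
    gcongr
  linarith

/-- A supermartingale inequality for small exploration boundaries. -/
theorem exp_step_le_of_small (h0 : 0 < ε) (h1 : ε < 1 / 10) (hθ0 : 0 ≤ θ) (hθ : θ ≤ ε / 50)
    (hd : 0 < d) (hm : (1 - θ) * d ≤ m) :
    (1 + ε) / d * exp (-(ε / 2) / d) ^ m + (1 - (1 + ε) / d) * (1 + ε ^ 2 / 4)⁻¹ ≤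
      exp (-(ε / 2) / d) * (1 + ε ^ 2 / 4)⁻¹ := by
  have hd' : (0 : ℝ) < d := by exact_mod_cast hd
  have hr : (0 : ℝ) < 1 + ε ^ 2 / 4 := by positivity
  have e : exp (-(ε / 2) / d) ^ m ≤ exp (-(ε / 2 * (1 - θ))) := by
    rw [← exp_nat_mul, exp_le_exp, mul_div_assoc', div_le_iff₀ hd']
    nlinarith
  have h2 := exp_neg_le_quadratic (y := ε / 2 * (1 - θ)) (mul_nonneg (by linarith) (by linarith))
  have h3 := add_one_le_exp (-(ε / 2) / d)
  rw [← div_eq_mul_inv, ← div_eq_mul_inv, le_div_iff₀ hr, add_mul, div_mul_cancel₀ _ hr.ne']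
  refine le_trans ?_ h3
  have h4 : exp (-(ε / 2) / d) ^ m * (1 + ε ^ 2 / 4) ≤ 1 - (ε / 2) / (1 + ε) := by
    refine (mul_le_mul_of_nonneg_right (e.trans h2) hr.le).trans ?_
    rw [le_sub_iff_add_le, ← le_sub_iff_add_le', div_le_iff₀ (by linarith)]
    have hu : ε / 2 - ε ^ 2 / 100 ≤ ε / 2 * (1 - θ) := by nlinarith
    have hu' : ε / 2 * (1 - θ) ≤ ε / 2 := by nlinarith
    set u := ε / 2 * (1 - θ)
    have hu0 : 0 ≤ u := mul_nonneg (by linarith) (by linarith)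
    have h5 : u ^ 2 ≤ ε ^ 2 / 4 := by nlinarith
    have h7 : (1 - u + u ^ 2 / 2) * (1 + ε ^ 2 / 4) ≤
        1 - u + u ^ 2 / 2 + ε ^ 2 / 4 := by
      nlinarith [mul_nonneg (sq_nonneg ε) (show 0 ≤ u - u ^ 2 / 2 by nlinarith)]
    have h8 : 1 - u + u ^ 2 / 2 + ε ^ 2 / 4 ≤ 1 - ε / 2 + 39 / 100 * ε ^ 2 := by linarith
    nlinarith [sq_nonneg ε, mul_nonneg (sq_nonneg ε) (show 0 ≤ 1 / 10 - ε by linarith)]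
  have h6 : (1 + ε) / d * (exp (-(ε / 2) / d) ^ m * (1 + ε ^ 2 / 4)) ≤
      (1 + ε) / d * (1 - (ε / 2) / (1 + ε)) := by gcongr
  have h7 : (1 + ε) / d * (1 - (ε / 2) / (1 + ε)) = (1 + ε) / d - ε / 2 / d := by
    have : (1 + ε) ≠ 0 := by positivity
    field_simp
  rw [neg_div] at h3 ⊢
  rw [neg_div] at h6
  rw [mul_assoc]
  linarith

/-- The exploration from below dominates while its parameter is less than the survival
parameter. -/
theorem exp_step_le (h0 : 0 < ε) (h1 : ε < 1 / 10) (hx : x ∈ Set.Ioo (0 : ℝ) 1)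
    (h : x = (1 + ε) * (1 - exp (-x))) (hξ : 0 ≤ ξ) (hξε : ξ ≤ ε / 4) (hd : 0 < d)
    (hθ0 : 0 ≤ θ) (hη0 : 0 ≤ η) (hη : 2 * η + 2 * θ ≤ ξ * ε / 4)
    (hp : (1 + ε - 2 * η) / d ≤ p) (hm : (1 - θ) * d ≤ m) :
    p * exp (-(x - ξ) / d) ^ m + (1 - p) ≤ exp (-(x - ξ) / d) := by
  have hd' : (0 : ℝ) < d := by exact_mod_cast hd
  have hx3 := lt_survival h0 h1 hx.1 h
  have ha : 0 ≤ x - ξ := by linarith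
  have hθ1 : θ ≤ 1 := by nlinarith
  have e : exp (-(x - ξ) / d) ^ m ≤ exp (-(x - ξ)) + θ := by
    have e1 : exp (-(x - ξ) / d) ^ m ≤ exp (-((x - ξ) * (1 - θ))) := by
      rw [← exp_nat_mul, exp_le_exp, mul_div_assoc', div_le_iff₀ hd']
      nlinarith
    have e2 := add_one_le_exp (-((x - ξ) * θ))
    have e3 : exp (-(x - ξ)) = exp (-((x - ξ) * (1 - θ))) * exp (-((x - ξ) * θ)) := by
      rw [← exp_add]; congr 1; ring
    have e4 : exp (-((x - ξ) * (1 - θ))) ≤ 1 := exp_le_one_iff.2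
      (neg_nonpos.2 (mul_nonneg ha (by linarith)))
    have e5 : (x - ξ) * θ ≤ θ := mul_le_of_le_one_left hθ0 (by linarith [hx.2])
    nlinarith [exp_pos (-((x - ξ) * (1 - θ))), mul_nonneg ha hθ0]
  have h2 := sub_survival_add_le h0 h1 hx h hξ hξε
  have h3 := add_one_le_exp (-(x - ξ) / d)
  have hE1 : exp (-(x - ξ)) ≤ 1 := exp_le_one_iff.2 (by linarith)
  have hE0 := exp_pos (-(x - ξ))
  have h4 : (x - ξ) / d ≤ (1 + ε - 2 * η) / d * (1 - exp (-(x - ξ) / d) ^ m) := by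
    rw [div_mul_eq_mul_div]
    gcongr
    have : 0 ≤ 1 + ε - 2 * η := by nlinarith
    have := mul_le_mul_of_nonneg_left e this
    nlinarith
  have h5 : (1 + ε - 2 * η) / d * (1 - exp (-(x - ξ) / d) ^ m) ≤
      p * (1 - exp (-(x - ξ) / d) ^ m) := by
    gcongr
    exact sub_nonneg.2 (pow_le_one₀ (exp_pos _).le (exp_le_one_iff.2
      (div_nonpos_of_nonpos_of_nonneg (by linarith) hd'.le)))
  rw [neg_div] at h3
  rw [neg_div] at *
  linarith

end Survival

section Expectation

variable {V : Type*} [Fintype V] [DecidableEq V] {G : SimpleGraph V} [DecidableRel G.Adj]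
  {d m K : ℕ} {p s s' r M : ℝ} {u v : V}

theorem pair_subset_nbhd (huv : G.Adj u v) : ({u, v} : Finset V) ⊆ nbhd G {u, v} := by
  intro w hw
  rcases mem_insert.1 hw with rfl | hw
  · exact mem_nbhd.2 ⟨v, by simp, huv.symm⟩
  · rw [mem_singleton.1 hw]
    exact mem_nbhd.2 ⟨u, by simp, huv⟩

theorem nbhd_singleton : nbhd G {v} = G.neighborFinset v := singleton_biUnion

theorem bexp_bigDegreeSum_le (h0 : 0 ≤ p) (h1 : p ≤ 1) (hG : G.IsRegularOfDegree d)
    (hs0 : 0 ≤ s) (hss : s ≤ s') (hs1 : s' ≤ 1) (hr0 : 0 ≤ r) (hr1 : r ≤ 1)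
    (hs : s ≤ p * s ^ d + (1 - p)) (hs' : p * s' ^ m + (1 - p) * r ≤ s' * r)
    (hM : ∀ D, #D < K → (#(overlapping G m D) : ℝ) ≤ M) (hK : 2 < K) :
    bexp p univ (fun S => (bigDegreeSum G K d S : ℝ)) ≤
      Fintype.card V * d * p ^ 2 * (1 - s ^ (2 * d) + r ^ (K - 2) + p * M) := by
  rw [bexp_bigDegreeSum hG]
  have key : ∀ u, ∀ v ∈ G.neighborFinset u,
      p ^ 2 * (1 - bprob p univ (fun S => #(cluster G {u, v} (S \ {u, v})) < K)) ≤
        p ^ 2 * (1 - s ^ (2 * d) + r ^ (K - 2) + p * M) := by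
    intro u v hv
    have huv : G.Adj u v := by simpa using hv
    have hc : #({u, v} : Finset V) = 2 := card_pair huv.ne
    refine mul_le_mul_of_nonneg_left ?_ (sq_nonneg p)
    have h := le_bprob_cluster h0 h1 hs0 hss hs1 hr0 hr1 (fun v => (hG v).le) hs hs' hM
      (subset_refl {u, v}) (pair_subset_nbhd huv) (hc.trans_lt hK)
    rw [hc] at h
    have hQ : #(nbhd G {u, v} \ {u, v}) ≤ 2 * d :=
      (card_le_card sdiff_subset).trans ((card_nbhd_le hG _).trans_eq (by rw [hc]))
    have h2 : s ^ (2 * d) ≤ s ^ #(nbhd G {u, v} \ {u, v}) :=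
      pow_le_pow_of_le_one hs0 (hss.trans hs1) hQ
    have h3 : s' ^ #(nbhd G {u, v} \ {u, v}) * r ^ (K - 2) ≤ r ^ (K - 2) :=
      mul_le_of_le_one_left (pow_nonneg hr0 _) (pow_le_one₀ (hs0.trans hss) hs1)
    have h4 : p * (M - #(({u, v} : Finset V) ∩ overlapping G m {u, v})) ≤ p * M :=
      mul_le_mul_of_nonneg_left (sub_le_self _ (Nat.cast_nonneg _)) h0
    linarith
  refine (sum_le_card_nsmul _ _ (d * (p ^ 2 * (1 - s ^ (2 * d) + r ^ (K - 2) + p * M)))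
    fun u _ => ?_).trans_eq (by rw [nsmul_eq_mul, card_univ]; ring)
  refine (sum_le_card_nsmul _ _ _ (key u)).trans_eq ?_
  rw [nsmul_eq_mul, SimpleGraph.card_neighborFinset_eq_degree, hG u]

theorem le_bexp_bigDegreeSum (h0 : 0 ≤ p) (h1 : p ≤ 1) (hG : G.IsRegularOfDegree d)
    (hs0 : 0 ≤ s) (hs1 : s ≤ 1) (hs : p * s ^ m + (1 - p) ≤ s)
    (hM : ∀ D, #D < K → (#(overlapping G m D) : ℝ) ≤ M) (hK : 2 < K) :
    Fintype.card V * p ^ 2 * (d * (1 - s ^ (d + m - 2) - p * M) - M) ≤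
      bexp p univ (fun S => (bigDegreeSum G K d S : ℝ)) := by
  rw [bexp_bigDegreeSum hG, mul_assoc, ← nsmul_eq_mul, ← card_univ]
  refine card_nsmul_le_sum _ _ _ fun u _ => ?_
  rw [← mul_sum]
  refine mul_le_mul_of_nonneg_left ?_ (sq_nonneg p)
  have hM0 : 0 ≤ M := (Nat.cast_nonneg _).trans (hM ∅ (by simp; omega))
  have key : ∀ v ∈ G.neighborFinset u,
      (1 - s ^ (d + m - 2) - p * M) - (if v ∈ overlapping G m {u} then 1 else 0) ≤
        1 - bprob p univ (fun S => #(cluster G {u, v} (S \ {u, v})) < K) := by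
    intro v hv
    have huv : G.Adj u v := by simpa using hv
    have hc : #({u, v} : Finset V) = 2 := card_pair huv.ne
    have hpM : 0 ≤ p * M := mul_nonneg h0 hM0
    split_ifs with ho
    · have := bprob_le_one (U := univ) (P := fun S => #(cluster G {u, v} (S \ {u, v})) < K) h0 h1
      linarith [pow_nonneg hs0 (d + m - 2)]
    · have h := bprob_cluster_le h0 h1 hs0 hs1 hs hM
        (subset_refl {u, v}) (pair_subset_nbhd huv) (hc.trans_lt hK)
      have h4 : p * (M - #(({u, v} : Finset V) ∩ overlapping G m {u, v})) ≤ p * M :=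
        mul_le_mul_of_nonneg_left (sub_le_self _ (Nat.cast_nonneg _)) h0
      have hQ : d + m - 2 ≤ #(nbhd G {u, v} \ {u, v}) := by
        rw [card_sdiff_of_subset (pair_subset_nbhd huv), hc]
        refine Nat.sub_le_sub_right ?_ 2
        have h5 : m ≤ #(G.neighborFinset v \ G.neighborFinset u) := by
          simpa [overlapping, nbhd_singleton] using ho
        have h6 : G.neighborFinset u ∪ (G.neighborFinset v \ G.neighborFinset u) ⊆
            nbhd G {u, v} := by
          rw [union_sdiff_self_eq_union, pair_comm, nbhd_insert, nbhd_singleton]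
        have h7 := card_le_card h6
        rw [card_union_of_disjoint disjoint_sdiff, SimpleGraph.card_neighborFinset_eq_degree,
          hG u] at h7
        omega
      linarith [pow_le_pow_of_le_one hs0 hs1 hQ]
  refine le_trans ?_ (sum_le_sum key)
  rw [sum_sub_distrib, sum_const, SimpleGraph.card_neighborFinset_eq_degree, hG u, nsmul_eq_mul,
    ← sum_filter, sum_const, nsmul_eq_mul, mul_one]
  have : (#{v ∈ G.neighborFinset u | v ∈ overlapping G m {u}} : ℝ) ≤ M := by
    refine le_trans ?_ (hM {u} (by simp; omega))
    exact_mod_cast card_le_card fun v hv => (mem_filter.1 hv).2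
  linarith

end Expectation

section Sprinkling

variable {V : Type*} [Fintype V] [DecidableEq V] {G : SimpleGraph V} [DecidableRel G.Adj]
  {d : ℕ} {lam : ℝ} {A B Y Z S T : Finset V}

theorem sum_degIn_comm (Y Z : Finset V) : ∑ z ∈ Z, degIn G Y z = ∑ y ∈ Y, degIn G Z y := by
  have h : ∀ (Y : Finset V) (z), degIn G Y z = ∑ y ∈ Y, if G.Adj y z then 1 else 0 := by
    intro Y z
    rw [← card_filter, degIn, ← filter_mem_eq_inter]
    simp [SimpleGraph.adj_comm]
  simp only [h]
  rw [sum_comm]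
  simp [SimpleGraph.adj_comm]

/-- Sets with many edges into `Y` have many neighbours in `Y`, unless some codegrees are large. -/
theorem sq_sum_degIn_le (Y Z : Finset V) :
    (∑ z ∈ Z, (degIn G Y z : ℝ)) ^ 2 ≤ #(Y ∩ nbhd G Z) * ∑ w, (degIn G Z w : ℝ) ^ 2 := by
  have e : ∑ z ∈ Z, (degIn G Y z : ℝ) = ∑ y ∈ Y ∩ nbhd G Z, (degIn G Z y : ℝ) := by
    have := sum_degIn_comm (G := G) Y Z
    rw [show ∑ z ∈ Z, (degIn G Y z : ℝ) = ∑ y ∈ Y, (degIn G Z y : ℝ) by exact_mod_cast this]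
    refine (sum_subset inter_subset_left fun y hy hyn => ?_).symm
    have : degIn G Z y = 0 := by
      rw [degIn, card_eq_zero, eq_empty_iff_forall_notMem]
      intro z hz
      simp only [mem_inter, SimpleGraph.mem_neighborFinset] at hz
      exact hyn (mem_inter.2 ⟨hy, mem_nbhd.2 ⟨z, hz.1, hz.2.symm⟩⟩)
    rw [this, Nat.cast_zero]
  rw [e]
  refine sq_sum_le_card_mul_sum_sq.trans (mul_le_mul_of_nonneg_left ?_ (Nat.cast_nonneg _))
  exact sum_le_sum_of_subset_of_nonneg (subset_univ _) fun _ _ _ => sq_nonneg _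

theorem le_card_inter_nbhd {b a c N : ℝ} (hN : 0 < N) (ha : 0 ≤ a) (hb : 0 ≤ b)
    (hZ : a ≤ #Z) (hY : ∀ z ∈ Z, b ≤ degIn G Y z)
    (hS : ∑ w, (degIn G Z w : ℝ) ^ 2 ≤ 6 * N) (hc : c * (6 * N) ≤ (a * b) ^ 2) :
    c ≤ #(Y ∩ nbhd G Z) := by
  have h1 : a * b ≤ ∑ z ∈ Z, (degIn G Y z : ℝ) := by
    refine (mul_le_mul_of_nonneg_right hZ hb).trans ?_
    rw [← nsmul_eq_mul]
    exact card_nsmul_le_sum _ _ _ hY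
  have h2 := sq_sum_degIn_le (G := G) Y Z
  have h3 := pow_le_pow_left₀ (mul_nonneg ha hb) h1 2
  have h4 : (#(Y ∩ nbhd G Z) : ℝ) * ∑ w, (degIn G Z w : ℝ) ^ 2 ≤
      #(Y ∩ nbhd G Z) * (6 * N) := by gcongr
  exact le_of_mul_le_mul_right (a := 6 * N) (by linarith) (by positivity)

theorem sum_degIn_sq_mono (h : S ⊆ T) :
    ∑ w, (degIn G S w : ℝ) ^ 2 ≤ ∑ w, (degIn G T w : ℝ) ^ 2 :=
  sum_le_sum fun w _ => by
    have : (degIn G S w : ℝ) ≤ degIn G T w := by exact_mod_cast degIn_mono h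
    gcongr

theorem bprob_card_inter_le {q c : ℝ} (h0 : 0 ≤ q) (h1 : q ≤ 1) (X : Finset V)
    (hX : 4 * c ≤ q * #X) :
    bprob q univ (fun S => (#(S ∩ X) : ℝ) ≤ c) ≤ Real.exp (-c) := by
  have h2 := bexp_pow_card_inter (p := q) (U := univ) (1 / 2) X
  have h3 : bprob q univ (fun S => (#(S ∩ X) : ℝ) ≤ c) ≤
      bexp q univ (fun S => (2 : ℝ) ^ c * (1 / 2 : ℝ) ^ #(S ∩ X)) := by
    refine bexp_mono h0 h1 fun S _ => ?_
    split_ifs with h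
    · rw [← Real.rpow_natCast, one_div, Real.inv_rpow (by norm_num), ← Real.rpow_neg (by norm_num),
        ← Real.rpow_add (by norm_num)]
      exact Real.one_le_rpow (by norm_num) (by linarith)
    · positivity
  rw [bexp_const_mul, h2, univ_inter] at h3
  have hc : (2 : ℝ) ^ c ≤ Real.exp c ∨ c < 0 := by
    rcases lt_or_ge c 0 with h | h
    · exact .inr h
    · left
      rw [← Real.exp_one_rpow]
      exact Real.rpow_le_rpow (by norm_num) (by linarith [Real.add_one_le_exp 1]) h
  rcases hc with hc | hc
  · have h4 : (1 - q + q * (1 / 2)) ^ #X ≤ Real.exp (-(2 * c)) := by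
      refine (pow_le_pow_left₀ (by linarith) (?_ : _ ≤ Real.exp (-(q / 2))) _).trans ?_
      · linarith [Real.add_one_le_exp (-(q / 2))]
      · rw [← Real.exp_nat_mul, Real.exp_le_exp]
        linarith
    refine h3.trans ((mul_le_mul hc h4 (pow_nonneg (by linarith) _) (Real.exp_pos _).le).trans ?_)
    rw [← Real.exp_add, Real.exp_le_exp]
    linarith
  · exact (bprob_le_one h0 h1).trans (Real.one_le_exp (by linarith))

theorem bprob_disjoint_le {q c : ℝ} (h1 : q ≤ 1) (X : Finset V) (hX : c ≤ q * #X) :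
    bprob q univ (fun S => S ∩ X = ∅) ≤ Real.exp (-c) := by
  have h2 := bexp_pow_card_inter (p := q) (U := univ) 0 X
  have h3 : bprob q univ (fun S => S ∩ X = ∅) = (1 - q) ^ #X := by
    rw [univ_inter, mul_zero, add_zero] at h2
    rw [← h2]
    refine bexp_congr fun S _ => ?_
    simp only [zero_pow_eq, card_eq_zero]
    congr
  rw [h3]
  refine (pow_le_pow_left₀ (by linarith) (?_ : _ ≤ Real.exp (-q)) _).trans ?_
  · linarith [Real.add_one_le_exp (-q)]
  · rw [← Real.exp_nat_mul, Real.exp_le_exp]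
    linarith

variable (G) in
/-- No path of length three leads from `A` to `B` with its second vertex in `S` and its third
vertex in `T`. -/
def Separated (A B S T : Finset V) : Prop :=
  ∀ x ∈ S ∩ nbhd G A, ∀ y ∈ T ∩ nbhd G B, ¬ G.Adj x y

/-- It is unlikely that two large sets are not joined by a short path through two random sets. -/
theorem bexp_separated_le (hP : Pseudorandom G d lam) (hG : G.IsRegularOfDegree d) (hd : 0 < d)
    {η c μ ν : ℝ} (hη0 : 0 ≤ η) (hηd : η ≤ d) (hc : 0 < c) (hμ : μ = c ^ 2 / 6)
    (hν : ν = (η * μ ^ 2 / 16) ^ 2 / 6) (hνμ : ν ≤ μ / 8)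
    (hlam : 8 * lam ^ 2 ≤ μ ^ 2 * d ^ 2)
    (hA : c * (Fintype.card V / d) ≤ #A) (hB : c * (Fintype.card V / d) ≤ #B)
    (hA2 : ∑ w, (degIn G A w : ℝ) ^ 2 ≤ 6 * Fintype.card V)
    (hB2 : ∑ w, (degIn G B w : ℝ) ^ 2 ≤ 6 * Fintype.card V) :
    bexp (η / d) univ (fun S => bprob (η / d) univ (fun T => Separated G A B S T ∧
      ∑ w, (degIn G S w : ℝ) ^ 2 ≤ 6 * Fintype.card V)) ≤
        2 * Real.exp (-(η * ν * (Fintype.card V / d))) := by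
  have hd' : (0 : ℝ) < d := by exact_mod_cast hd
  set N : ℝ := (Fintype.card V : ℝ)
  have hμ0 : 0 < μ := hμ ▸ by positivity
  have hN0 : 0 ≤ N := Nat.cast_nonneg _
  have hq0 : 0 ≤ η / d := by positivity
  have hq1 : η / d ≤ 1 := (div_le_one hd').2 hηd
  rcases hN0.eq_or_lt with hN | hN
  · rw [← hN]
    simp only [zero_div, mul_zero, neg_zero, Real.exp_zero, mul_one]
    refine (bexp_mono hq0 hq1 fun S _ => bprob_le_one hq0 hq1).trans ?_
    rw [bexp_const]
    norm_num
  have hdeg : ∀ z, (d : ℝ) ≤ degIn G univ z := fun z => by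
    rw [degIn, univ_inter, SimpleGraph.card_neighborFinset_eq_degree, hG z]
  have hcN : μ * N * (6 * N) ≤ (c * (N / d) * d) ^ 2 := by
    rw [hμ]; field_simp; rfl
  have hNA : μ * N ≤ #(nbhd G A) := by
    simpa using le_card_inter_nbhd (Y := univ) hN (by positivity) hd'.le hA
      (fun z _ => hdeg z) hA2 hcN
  have hNB : μ * N ≤ #(nbhd G B) := by
    simpa using le_card_inter_nbhd (Y := univ) hN (by positivity) hd'.le hB
      (fun z _ => hdeg z) hB2 hcN
  set Y := nbhd G B
  have hY0 : (0 : ℝ) < #Y := lt_of_lt_of_le (by positivity) hNB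
  set L : Finset V := {w | (degIn G Y w : ℝ) < d * #Y / (2 * N)} with hL
  set X := nbhd G A \ L
  have hXY : ∀ x ∈ X, μ * d / 2 ≤ degIn G Y x := by
    intro x hx
    have h1 : (d * #Y / (2 * N) : ℝ) ≤ degIn G Y x := by simpa [L] using (mem_sdiff.1 hx).2
    refine le_trans ?_ h1
    rw [div_le_div_iff₀ (by norm_num) (by positivity)]
    nlinarith
  have hX : μ * N / 2 ≤ #X := by
    have h1 := hP.card_lt_half_le hd' (Y := Y) (card_pos.1 (by exact_mod_cast hY0))
    have h2 : 4 * lam ^ 2 * N ^ 2 / (d ^ 2 * #Y) ≤ μ * N / 2 := by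
      rw [div_le_div_iff₀ (by positivity) (by norm_num)]
      have h3 : μ * N * (d ^ 2 * (μ * N)) ≤ μ * N * (d ^ 2 * #Y) := by gcongr
      have h4 : 8 * lam ^ 2 * N ^ 2 ≤ μ ^ 2 * d ^ 2 * N ^ 2 := by gcongr
      nlinarith
    have h3 : (#(nbhd G A) : ℝ) ≤ #X + #L := by
      exact_mod_cast tsub_le_iff_right.1 (le_card_sdiff L (nbhd G A))
    rw [← hL] at h1
    linarith
  set a := η * μ / 8 * (N / d) with ha
  have ha0 : 0 ≤ a := by positivity
  have hsmall := bprob_card_inter_le hq0 hq1 (c := a) X (by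
    rw [ha]
    have : η / d * (μ * N / 2) ≤ η / d * #X := by gcongr
    refine le_trans (le_of_eq ?_) this
    field_simp; ring)
  have hEa : Real.exp (-a) ≤ Real.exp (-(η * ν * (N / d))) := by
    rw [Real.exp_le_exp, ha, neg_le_neg_iff]
    have : η * ν ≤ η * μ / 8 := by nlinarith
    gcongr
  have hpt : ∀ S : Finset V, bprob (η / d) univ (fun T => Separated G A B S T ∧
      ∑ w, (degIn G S w : ℝ) ^ 2 ≤ 6 * N) ≤
        (open Classical in if (#(S ∩ X) : ℝ) ≤ a then 1 else 0) +
          Real.exp (-(η * ν * (N / d))) := by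
    intro S
    split_ifs with h
    · linarith [bprob_le_one (U := univ) (P := fun T => Separated G A B S T ∧
        ∑ w, (degIn G S w : ℝ) ^ 2 ≤ 6 * N) hq0 hq1, Real.exp_pos (-(η * ν * (N / d)))]
    rw [zero_add]
    by_cases hS : ∑ w, (degIn G S w : ℝ) ^ 2 ≤ 6 * N
    swap
    · simp only [hS, and_false]
      exact ((bexp_congr fun S _ => if_neg not_false).trans (bexp_const 0)).trans_le
        (Real.exp_pos _).le
    push Not at h
    have hW : ν * N ≤ #(Y ∩ nbhd G (S ∩ X)) := by
      refine le_card_inter_nbhd hN ha0 (by positivity) h.le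
        (fun z hz => hXY z (mem_inter.1 hz).2) ((sum_degIn_sq_mono inter_subset_left).trans hS) ?_
      rw [ha, hν]
      refine le_of_eq ?_
      field_simp; ring
    refine (bprob_mono hq0 hq1 fun T _ hT => ?_).trans
      (bprob_disjoint_le hq1 (Y ∩ nbhd G (S ∩ X)) ?_)
    · rw [eq_empty_iff_forall_notMem]
      intro y hy
      simp only [mem_inter] at hy
      obtain ⟨z, hz, hzy⟩ := mem_nbhd.1 hy.2.2
      rw [mem_inter] at hz
      exact hT.1 z (mem_inter.2 ⟨hz.1, (mem_sdiff.1 hz.2).1⟩) y (mem_inter.2 ⟨hy.1, hy.2.1⟩) hzy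
    · have : η / d * (ν * N) ≤ η / d * #(Y ∩ nbhd G (S ∩ X)) := by gcongr
      refine le_trans (le_of_eq ?_) this
      field_simp
  refine (bexp_mono hq0 hq1 fun S _ => hpt S).trans ?_
  rw [bexp_add, bexp_const, two_mul]
  exact add_le_add_left (hsmall.trans hEa) _

end Sprinkling

theorem bprob_exists_le {α ι : Type*} {p : ℝ} {U : Finset α} (h0 : 0 ≤ p) (h1 : p ≤ 1)
    (s : Finset ι) (P : ι → Finset α → Prop) :
    bprob p U (fun S => ∃ i ∈ s, P i S) ≤ ∑ i ∈ s, bprob p U (P i) := by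
  classical
  simp only [bprob]
  rw [← bexp_sum]
  refine bexp_mono h0 h1 fun S _ => ?_
  split_ifs with h
  · obtain ⟨i, hi, hP⟩ := h
    refine le_trans (by rw [if_pos hP]) (single_le_sum (f := fun i => if P i S then (1 : ℝ) else 0)
      (fun j _ => by split_ifs <;> norm_num) hi)
  · exact sum_nonneg fun j _ => by split_ifs <;> norm_num

section BigClusters

variable {V : Type*} [Fintype V] [DecidableEq V] (G : SimpleGraph V)

/-- The vertex sets of the components with at least `K` vertices of the subgraph induced on
`S`. -/
noncomputable def bigClusters (K : ℕ) (S : Finset V) : Finset (Finset V) :=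
  (bigVerts G K S).image fun u => cluster G {u} S

variable {G} {K : ℕ} {S : Finset V}

theorem card_bigClusters_mul_le : #(bigClusters G K S) * K ≤ #S := by
  have hle : #(bigVerts G K S) ≤ #S := card_le_card (filter_subset _ _)
  refine le_trans ?_ hle
  rw [bigClusters, card_eq_sum_card_image (fun u => cluster G {u} S) (bigVerts G K S),
    ← smul_eq_mul]
  refine card_nsmul_le_sum _ _ _ fun C hC => ?_
  obtain ⟨u, hu, rfl⟩ := mem_image.1 hC
  obtain ⟨huS, hK⟩ := mem_bigVerts.1 hu
  refine hK.trans (card_le_card fun v hv => ?_)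
  have e := cluster_eq_of_mem huS hv
  exact mem_filter.2 ⟨mem_bigVerts.2 ⟨cluster_subset_of_mem huS hv, e ▸ hK⟩, e⟩

variable (G) in
/-- The vertices of the components in `F` of the subgraph induced on `S`. -/
noncomputable def clusterUnion (K : ℕ) (S : Finset V) (F : Finset (Finset V)) : Finset V :=
  (bigVerts G K S).filter fun u => cluster G {u} S ∈ F

end BigClusters

section Connecting

variable {V : Type*} [Fintype V] [DecidableEq V] {G : SimpleGraph V} [DecidableRel G.Adj]
  {d K : ℕ} {lam : ℝ} {S : Finset V}

theorem mul_card_le_sum_degIn_sq (hG : G.IsRegularOfDegree d) :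
    (d : ℝ) * #S ≤ ∑ w, (degIn G S w : ℝ) ^ 2 := by
  have h := sum_degIn_comm (G := G) univ S
  have h2 : ∑ z ∈ S, degIn G univ z = #S * d := by
    rw [sum_const_nat]
    intro z _
    rw [degIn, univ_inter, SimpleGraph.card_neighborFinset_eq_degree, hG z]
  rw [h2] at h
  rw [mul_comm, ← Nat.cast_mul, h, Nat.cast_sum]
  refine sum_le_sum fun w _ => ?_
  exact_mod_cast Nat.le_self_pow two_ne_zero _

variable (G) in
/-- The large components of the subgraph induced on `S` can be split into two families with at
least `c` vertices each that are not joined by short paths through `S'` and `S''`. -/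
def SplitBy (K : ℕ) (c : ℝ) (S S' S'' : Finset V) : Prop :=
  ∃ F ∈ (bigClusters G K S).powerset, c ≤ #(clusterUnion G K S F) ∧
    c ≤ #(bigVerts G K S \ clusterUnion G K S F) ∧
      Separated G (clusterUnion G K S F) (bigVerts G K S \ clusterUnion G K S F) S' S''

/-- Sprinkling joins the large components, with high probability. -/
theorem bexp_splitBy_le (hP : Pseudorandom G d lam) (hG : G.IsRegularOfDegree d) (hd : 0 < d)
    {p η c μ ν : ℝ} (h0 : 0 ≤ p) (h1 : p ≤ 1) (hη0 : 0 ≤ η) (hηd : η ≤ d) (hc : 0 < c)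
    (hμ : μ = c ^ 2 / 6) (hν : ν = (η * μ ^ 2 / 16) ^ 2 / 6) (hνμ : ν ≤ μ / 8)
    (hlam : 8 * lam ^ 2 ≤ μ ^ 2 * d ^ 2) (hK : 12 ≤ η * ν * K) :
    bexp p univ (fun S => bexp (η / d) univ fun S' => bprob (η / d) univ fun S'' =>
      SplitBy G K (c * (Fintype.card V / d)) S S' S'' ∧
        ∑ w, (degIn G (S ∪ S' ∪ S'') w : ℝ) ^ 2 ≤ 6 * Fintype.card V) ≤
      2 * Real.exp (-(η * ν / 2 * (Fintype.card V / d))) := by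
  classical
  have hd' : (0 : ℝ) < d := by exact_mod_cast hd
  have hq0 : 0 ≤ η / d := by positivity
  have hq1 : η / d ≤ 1 := (div_le_one hd').2 hηd
  set N : ℝ := (Fintype.card V : ℝ)
  have hN0 : 0 ≤ N := Nat.cast_nonneg _
  have hE : 0 < 2 * Real.exp (-(η * ν / 2 * (N / d))) := by positivity
  refine (bexp_mono h0 h1 fun S _ => ?_).trans_eq
    (bexp_const (2 * Real.exp (-(η * ν / 2 * (N / d)))))
  by_cases hS : ∑ w, (degIn G S w : ℝ) ^ 2 ≤ 6 * N
  swap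
  · refine le_trans (le_of_eq ?_) hE.le
    refine (bexp_congr fun S' _ => (bexp_congr fun S'' _ => if_neg fun h => hS ?_).trans
      (bexp_const 0)).trans (bexp_const 0)
    exact (sum_degIn_sq_mono (subset_union_left.trans subset_union_left)).trans h.2
  have hpt : ∀ F ∈ (bigClusters G K S).powerset,
      bexp (η / d) univ (fun S' => bprob (η / d) univ fun S'' =>
        (c * (N / d) ≤ #(clusterUnion G K S F) ∧
          c * (N / d) ≤ #(bigVerts G K S \ clusterUnion G K S F)) ∧
        Separated G (clusterUnion G K S F) (bigVerts G K S \ clusterUnion G K S F) S' S'' ∧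
          ∑ w, (degIn G S' w : ℝ) ^ 2 ≤ 6 * N) ≤
        2 * Real.exp (-(η * ν * (N / d))) := by
    intro F _
    by_cases hF : c * (N / d) ≤ #(clusterUnion G K S F) ∧
        c * (N / d) ≤ #(bigVerts G K S \ clusterUnion G K S F)
    · simp only [hF, true_and, and_self]
      have hsub : clusterUnion G K S F ⊆ S := (filter_subset _ _).trans (filter_subset _ _)
      have hsub' : bigVerts G K S \ clusterUnion G K S F ⊆ S :=
        sdiff_subset.trans (filter_subset _ _)
      exact bexp_separated_le hP hG hd hη0 hηd hc hμ hν hνμ hlam hF.1 hF.2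
        ((sum_degIn_sq_mono hsub).trans hS) ((sum_degIn_sq_mono hsub').trans hS)
    · refine le_trans (le_of_eq ?_) (by positivity)
      exact (bexp_congr fun S' _ => (bexp_congr fun S'' _ => if_neg fun h => hF h.1).trans
        (bexp_const 0)).trans (bexp_const 0)
  calc _ ≤ bexp (η / d) univ (fun S' => ∑ F ∈ (bigClusters G K S).powerset,
          bprob (η / d) univ fun S'' =>
            (c * (N / d) ≤ #(clusterUnion G K S F) ∧
              c * (N / d) ≤ #(bigVerts G K S \ clusterUnion G K S F)) ∧
            Separated G (clusterUnion G K S F) (bigVerts G K S \ clusterUnion G K S F) S' S'' ∧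
              ∑ w, (degIn G S' w : ℝ) ^ 2 ≤ 6 * N) := by
        refine bexp_mono hq0 hq1 fun S' _ => (bprob_mono hq0 hq1 fun S'' _ h => ?_).trans
          (bprob_exists_le hq0 hq1 _ _)
        obtain ⟨⟨F, hF, h1, h2, h3⟩, h4⟩ := h
        exact ⟨F, hF, ⟨h1, h2⟩, h3, (sum_degIn_sq_mono
          (subset_union_right.trans subset_union_left)).trans h4⟩
    _ ≤ 2 ^ #(bigClusters G K S) * (2 * Real.exp (-(η * ν * (N / d)))) := by
        rw [bexp_sum]
        refine (sum_le_card_nsmul _ _ _ hpt).trans_eq ?_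
        rw [nsmul_eq_mul, card_powerset]
        push_cast
        rfl
    _ ≤ _ := by
        have hb : (d : ℝ) * (#(bigClusters G K S) * K) ≤ 6 * N := by
          refine le_trans ?_ ((mul_card_le_sum_degIn_sq hG).trans hS)
          gcongr
          exact_mod_cast card_bigClusters_mul_le
        have hην : 0 ≤ η * ν := mul_nonneg hη0 (hν ▸ by positivity)
        have hb' : (#(bigClusters G K S) : ℝ) ≤ η * ν / 2 * (N / d) := by
          rw [mul_div_assoc', le_div_iff₀ hd']
          have h1 := mul_le_mul_of_nonneg_left hb hην
          have h2 := mul_le_mul_of_nonneg_left hK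
            (mul_nonneg (Nat.cast_nonneg (α := ℝ) (#(bigClusters G K S))) hd'.le)
          nlinarith
        have h2 : (2 : ℝ) ^ #(bigClusters G K S) ≤ Real.exp (η * ν / 2 * (N / d)) := by
          refine (pow_le_pow_left₀ (by norm_num) (?_ : (2 : ℝ) ≤ Real.exp 1) _).trans ?_
          · linarith [Real.add_one_le_exp 1]
          · rw [← Real.exp_nat_mul, Real.exp_le_exp]
            linarith
        calc _ ≤ Real.exp (η * ν / 2 * (N / d)) * (2 * Real.exp (-(η * ν * (N / d)))) := by gcongr
          _ = _ := by
            rw [mul_left_comm, ← Real.exp_add]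
            congr 2
            ring

end Connecting

theorem cluster_subset_bigVerts {V : Type*} [Fintype V] {G : SimpleGraph V} {S : Finset V} {u : V}
    {K : ℕ} (hu : u ∈ S) (hK : K ≤ #(cluster G {u} S)) :
    cluster G {u} S ⊆ bigVerts G K S := fun v hv =>
  mem_bigVerts.2 ⟨cluster_subset_of_mem hu hv, by rwa [cluster_eq_of_mem hu hv]⟩

section Merging

variable {V : Type*} [Fintype V] [DecidableEq V] {G : SimpleGraph V} [DecidableRel G.Adj]
  {d K H : ℕ} {c : ℝ} {S S₁ S' S'' : Finset V} {a u : V}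

/-- If the large components cannot be split, then almost all of their vertices end up in one
component. -/
theorem exists_card_sdiff_cluster_lt (hS : ¬ SplitBy G K c S₁ S' S'') (hc : 0 < c)
    (hX : c ≤ #(bigVerts G K S₁)) :
    ∃ a ∈ bigVerts G K S₁,
      (#(bigVerts G K S₁ \ cluster G {a} (S₁ ∪ S' ∪ S'')) : ℝ) < 2 * c := by
  classical
  set S := S₁ ∪ S' ∪ S''
  set X := bigVerts G K S₁
  have hXS₁ : X ⊆ S₁ := filter_subset _ _
  have hS₁S : S₁ ⊆ S := subset_union_left.trans subset_union_left
  have hXS : X ⊆ S := hXS₁.trans hS₁S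
  set Q := X.powerset.filter fun A =>
    c ≤ #A ∧ ∀ a ∈ A, ∀ b ∈ X, b ∈ cluster G {a} S → b ∈ A
  have hQ : Q.Nonempty := ⟨X, by simp [Q, hX]; tauto⟩
  obtain ⟨A, hAQ, hmin⟩ := exists_min_image Q card hQ
  obtain ⟨hAX, hcA, hA⟩ : A ⊆ X ∧ c ≤ #A ∧ ∀ a ∈ A, ∀ b ∈ X, b ∈ cluster G {a} S → b ∈ A := by
    simpa [Q] using hAQ
  have hU : clusterUnion G K S₁ (A.image fun u => cluster G {u} S₁) = A := by
    ext u
    simp only [clusterUnion, mem_filter, mem_image]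
    refine ⟨?_, fun hu => ⟨hAX hu, u, hu, rfl⟩⟩
    rintro ⟨hu, b, hb, hbu⟩
    exact hA b hb u hu (cluster_mono subset_rfl hS₁S (hbu ▸ self_mem_cluster))
  have hlt : (#(X \ A) : ℝ) < c := by
    by_contra! hge
    refine hS ⟨A.image fun u => cluster G {u} S₁, mem_powerset.2 (image_subset_image hAX), ?_⟩
    rw [hU]
    refine ⟨hcA, hge, fun x hx y hy hxy => ?_⟩
    obtain ⟨hxS, hxA⟩ := mem_inter.1 hx
    obtain ⟨hyS, hyB⟩ := mem_inter.1 hy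
    obtain ⟨a, ha, hax⟩ := mem_nbhd.1 hxA
    obtain ⟨b, hb, hby⟩ := mem_nbhd.1 hyB
    obtain ⟨hbX, hbA⟩ := mem_sdiff.1 hb
    refine hbA (hA a ha b hbX ?_)
    have h1 : x ∈ cluster G {a} S := cluster_step self_mem_cluster hax
      (subset_union_left (subset_union_right hxS))
    exact cluster_step (cluster_step h1 hxy (subset_union_right hyS)) hby.symm (hXS hbX)
  obtain ⟨a, ha⟩ : A.Nonempty := card_pos.1 (by exact_mod_cast hc.trans_le hcA)
  have hA' : (#(A \ cluster G {a} S) : ℝ) < c := by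
    by_contra! hge
    have hlt : #(A \ cluster G {a} S) < #A :=
      card_lt_card ⟨sdiff_subset, fun h => (mem_sdiff.1 (h ha)).2 self_mem_cluster⟩
    refine (hmin _ ?_).not_gt hlt
    simp only [Q, mem_filter, mem_powerset]
    refine ⟨sdiff_subset.trans hAX, hge, fun b hb e he hbe => ?_⟩
    obtain ⟨hbA, hb⟩ := mem_sdiff.1 hb
    refine mem_sdiff.2 ⟨hA b hbA e he hbe, fun h => hb ?_⟩
    rw [← cluster_eq_of_mem (hXS (hAX ha)) h]
    exact cluster_symm (hXS (hAX hbA)) hbe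
  refine ⟨a, hAX ha, ?_⟩
  have hsub : X \ cluster G {a} S ⊆ (X \ A) ∪ (A \ cluster G {a} S) := fun v hv => by
    simp only [mem_sdiff, mem_union] at hv ⊢
    tauto
  have := (card_le_card hsub).trans (card_union_le _ _)
  have : (#(X \ cluster G {a} S) : ℝ) ≤ #(X \ A) + #(A \ cluster G {a} S) := by exact_mod_cast this
  linarith

theorem card_le_sum_degIn (hu : u ∈ S) (h : 1 < #(cluster G {u} S)) :
    #(cluster G {u} S) ≤ ∑ v ∈ cluster G {u} S, degIn G S v := by
  rw [card_eq_sum_ones]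
  refine sum_le_sum fun v hv => ?_
  by_contra! h0
  have h1 : cluster G {v} S = {v} := by
    refine cluster_eq_self fun a ha b hb hab => ?_
    rw [mem_singleton.1 ha] at hab
    refine absurd h0 (not_lt.2 (card_pos.2 ⟨b, mem_inter.2 ⟨hb, ?_⟩⟩))
    exact (SimpleGraph.mem_neighborFinset _ _ _).2 hab
  rw [← cluster_eq_of_mem hu hv, h1] at h
  simp at h

theorem degIn_le (hG : G.IsRegularOfDegree d) : degIn G S u ≤ d := by
  rw [← hG u, ← SimpleGraph.card_neighborFinset_eq_degree]
  exact card_le_card inter_subset_right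

/-- The number of edges of a largest component, when almost all vertices of the large components
of a smaller set lie in one component. -/
theorem sum_degIn_largest (hG : G.IsRegularOfDegree d) (hS : S₁ ⊆ S) (hK : 1 < K)
    (ha : a ∈ bigVerts G K S₁) (hc : (#(bigVerts G K S₁ \ cluster G {a} S) : ℝ) ≤ c)
    (hX : K + c ≤ #(bigVerts G K S₁))
    (hF : bigDegreeSum G K d S + c <
      bigDegreeSum G K H S₁ - c * H + #(bigVerts G K S₁))
    (hu : u ∈ S) (hmax : ∀ v ∈ S, #(cluster G {v} S) ≤ #(cluster G {u} S)) :
    bigDegreeSum G K H S₁ - c * H ≤ ∑ v ∈ cluster G {u} S, (degIn G S v : ℝ) ∧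
      ∑ v ∈ cluster G {u} S, (degIn G S v : ℝ) ≤ bigDegreeSum G K d S := by
  set X := bigVerts G K S₁
  have hXS : X ⊆ S := (filter_subset _ _).trans hS
  have hcard : (#X : ℝ) ≤ #(cluster G {a} S) + #(X \ cluster G {a} S) := by
    have := card_inter_add_card_sdiff X (cluster G {a} S)
    have h2 := card_le_card (inter_subset_right : X ∩ cluster G {a} S ⊆ _)
    exact_mod_cast (by omega : #X ≤ #(cluster G {a} S) + #(X \ cluster G {a} S))
  have hle : #(cluster G {a} S) ≤ #(cluster G {u} S) := hmax a (hXS ha)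
  have hKa : K ≤ #(cluster G {a} S) := by
    exact_mod_cast (by linarith : (K : ℝ) ≤ #(cluster G {a} S))
  have hsum : ∀ T ⊆ bigVerts G K S, ∑ v ∈ T, degIn G S v ≤ bigDegreeSum G K d S := fun T hT =>
    (sum_le_sum_of_subset hT).trans_eq
      (sum_congr rfl fun v _ => (min_eq_left (degIn_le hG)).symm)
  have hUs := cluster_subset_bigVerts hu (hKa.trans hle)
  have hAs := cluster_subset_bigVerts (hXS ha) hKa
  have hlow : bigDegreeSum G K H S₁ - c * H ≤ ∑ v ∈ cluster G {a} S, (degIn G S v : ℝ) := by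
    have h1 : bigDegreeSum G K H S₁ ≤
        ∑ v ∈ cluster G {a} S, degIn G S v + #(X \ cluster G {a} S) * H := by
      rw [bigDegreeSum, ← sum_inter_add_sum_sdiff (bigVerts G K S₁) (cluster G {a} S)]
      refine add_le_add ?_ ?_
      · exact (sum_le_sum fun v _ => (min_le_left _ _).trans (degIn_mono hS)).trans
          (sum_le_sum_of_subset inter_subset_right)
      · rw [← smul_eq_mul]
        exact sum_le_card_nsmul _ _ _ fun v _ => min_le_right _ _
    have h2 : (bigDegreeSum G K H S₁ : ℝ) ≤
        ∑ v ∈ cluster G {a} S, (degIn G S v : ℝ) + #(X \ cluster G {a} S) * H := by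
      exact_mod_cast h1
    have := mul_le_mul_of_nonneg_right hc (Nat.cast_nonneg (α := ℝ) H)
    linarith
  have hup : ∑ v ∈ cluster G {u} S, (degIn G S v : ℝ) ≤ bigDegreeSum G K d S := by
    exact_mod_cast hsum _ hUs
  refine ⟨?_, hup⟩
  suffices h : cluster G {u} S = cluster G {a} S by rwa [h]
  by_contra hne
  have hdisj : Disjoint (cluster G {u} S) (cluster G {a} S) := by
    rw [disjoint_left]
    intro v hvu hva
    exact hne ((cluster_eq_of_mem hu hvu).symm.trans (cluster_eq_of_mem (hXS ha) hva))
  have h1 := hsum _ (union_subset hUs hAs)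
  rw [sum_union hdisj] at h1
  have h2 := card_le_sum_degIn hu (hK.trans_le (hKa.trans hle))
  have h3 : (#(cluster G {a} S) : ℝ) + ∑ v ∈ cluster G {a} S, (degIn G S v : ℝ) ≤
      bigDegreeSum G K d S := by exact_mod_cast (by omega)
  linarith

end Merging

section Percolation

open MeasureTheory

theorem isProbabilityMeasure_bernoulliMeasure {p : ℝ} (h0 : 0 ≤ p) (h1 : p ≤ 1) :
    IsProbabilityMeasure (bernoulliMeasure p) := ⟨by
  simp [bernoulliMeasure, ← ENNReal.ofReal_add h0 (sub_nonneg.2 h1)]⟩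

/-- Events of the site percolation measure as events of a random finite set. -/
theorem percolationMeasure_setOf {V : Type*} [Fintype V] [DecidableEq V] {p : ℝ} (h0 : 0 ≤ p)
    (h1 : p ≤ 1) (P : Finset V → Prop) :
    percolationMeasure V p {ω | P (univ.filter fun v => ω v = true)} =
      ENNReal.ofReal (bprob p univ P) := by
  classical
  have := isProbabilityMeasure_bernoulliMeasure h0 h1
  have hsingle : ∀ S : Finset V, percolationMeasure V p {fun v => decide (v ∈ S)} =
      ENNReal.ofReal (p ^ #S * (1 - p) ^ (#(univ : Finset V) - #S)) := by
    intro S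
    rw [percolationMeasure, Measure.pi_singleton]
    have h : ∀ v, bernoulliMeasure p {decide (v ∈ S)} =
        ENNReal.ofReal (if v ∈ S then p else 1 - p) := by
      intro v
      by_cases hv : v ∈ S <;> simp [bernoulliMeasure, hv]
    simp_rw [h]
    rw [← ENNReal.ofReal_prod_of_nonneg fun v _ => by split_ifs <;> linarith, prod_ite]
    simp only [prod_const, filter_mem_eq_inter, univ_inter]
    congr 3
    rw [card_univ, ← card_compl, compl_eq_univ_sdiff, sdiff_eq_filter]
  have hset : {ω : V → Bool | P (univ.filter fun v => ω v = true)} =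
      ((univ.filter P).image fun S v => decide (v ∈ S) : Finset (V → Bool)) := by
    ext ω
    simp only [Set.mem_ofPred_eq, coe_image, Set.mem_image, coe_filter, mem_univ, true_and]
    constructor
    · exact fun h => ⟨_, h, by ext; simp⟩
    · rintro ⟨S, hS, rfl⟩
      simpa using hS
  rw [hset, ← sum_measure_singleton, sum_image, bprob, bexp, powerset_univ]
  · simp_rw [hsingle, mul_ite, mul_one, mul_zero]
    rw [← sum_filter, ENNReal.ofReal_sum_of_nonneg]
    intro S _
    have := sub_nonneg.2 h1
    positivity
  · intro S _ T _ h
    ext v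
    simpa using congrFun h v

end Percolation

section Components

variable {V : Type*} [Fintype V] {G : SimpleGraph V} {s : Set V} {S : Finset V}

theorem image_supp_eq_cluster (hs : ∀ v, v ∈ s ↔ v ∈ S) (u : s) :
    Subtype.val '' ((G.induce s).connectedComponentMk u).supp = (cluster G {u.1} S : Set V) := by
  ext v
  simp only [Set.mem_image, SimpleGraph.ConnectedComponent.mem_supp_iff,
    SimpleGraph.ConnectedComponent.eq, mem_coe]
  constructor
  · rintro ⟨w, hw, rfl⟩
    have h := (SimpleGraph.reachable_iff_reflTransGen _ _).1 hw.symm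
    induction h with
    | refl => exact self_mem_cluster
    | @tail b c _ hbc ih => 
      refine cluster_step (ih ?_) (by simpa using hbc) ((hs _).1 c.2)
      exact (hbc.reachable.trans hw)
  · intro hv
    classical
    have : cluster G {u.1} S ⊆ univ.filter fun v =>
        ∃ w : s, (G.induce s).Reachable w u ∧ w.1 = v := by
      refine cluster_subset (by simp) fun a ha b hb hab => ?_
      obtain ⟨w, hw, rfl⟩ := (mem_filter.1 ha).2
      refine mem_filter.2 ⟨mem_univ _, ⟨b, (hs b).2 hb⟩, ?_, rfl⟩
      have hadj : (G.induce s).Adj ⟨b, (hs b).2 hb⟩ w := by simpa using hab.symm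
      exact hadj.reachable.trans hw
    exact (mem_filter.1 (this hv)).2

theorem ncard_supp (hs : ∀ v, v ∈ s ↔ v ∈ S) (u : s) :
    ((G.induce s).connectedComponentMk u).supp.ncard = #(cluster G {u.1} S) := by
  rw [← Set.ncard_image_of_injective _ Subtype.val_injective, image_supp_eq_cluster hs u,
    Set.ncard_coe_finset]

theorem two_mul_ncard_edgeSet [DecidableEq V] [DecidableRel G.Adj] (hs : ∀ v, v ∈ s ↔ v ∈ S)
    (u : s) :
    2 * ((G.induce s).induce ((G.induce s).connectedComponentMk u).supp).edgeSet.ncard =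
      ∑ v ∈ cluster G {u.1} S, degIn G S v := by
  classical
  set C := ((G.induce s).connectedComponentMk u).supp
  have hC : ∀ v, v ∈ cluster G {u.1} S ↔ ∃ w ∈ C, w.1 = v := fun v => by
    rw [← mem_coe, ← image_supp_eq_cluster hs u, Set.mem_image]
  rw [← SimpleGraph.coe_edgeFinset, Set.ncard_coe_finset,
    ← SimpleGraph.sum_degrees_eq_twice_card_edges]
  refine sum_nbij (fun v => v.1.1) (fun v _ => (hC _).2 ⟨v.1, v.2, rfl⟩)
    (fun v _ w _ h => Subtype.ext (Subtype.ext h)) (fun v hv => ?_) fun v _ => ?_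
  · obtain ⟨w, hw, rfl⟩ := (hC v).1 hv
    exact ⟨⟨w, hw⟩, mem_coe.2 (mem_univ _), rfl⟩
  · rw [← SimpleGraph.card_neighborFinset_eq_degree, degIn]
    refine card_bij (fun w _ => w.1.1) (fun w hw => ?_)
      (fun w _ w' _ h => Subtype.ext (Subtype.ext h)) fun b hb => ?_
    · rw [SimpleGraph.mem_neighborFinset] at hw
      exact mem_inter.2 ⟨(hs _).1 w.1.2, (SimpleGraph.mem_neighborFinset _ _ _).2 hw⟩
    · obtain ⟨hbS, hb⟩ := mem_inter.1 hb
      rw [SimpleGraph.mem_neighborFinset] at hb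
      have hbc : b ∈ cluster G {u.1} S := cluster_step ((hC _).2 ⟨v.1, v.2, rfl⟩) hb hbS
      obtain ⟨w, hw, rfl⟩ := (hC b).1 hbc
      exact ⟨⟨w, hw⟩, (SimpleGraph.mem_neighborFinset _ _ _).2 hb, rfl⟩

/-- Statements about the largest component in terms of clusters. -/
theorem exists_largest_component [DecidableEq V] [DecidableRel G.Adj]
    (hs : ∀ v, v ∈ s ↔ v ∈ S) (hS : S.Nonempty) {P : ℝ → Prop}
    (h : ∀ u ∈ S, (∀ v ∈ S, #(cluster G {v} S) ≤ #(cluster G {u} S)) →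
      P ((∑ v ∈ cluster G {u} S, (degIn G S v : ℝ)) / 2)) :
    ∃ C : (G.induce s).ConnectedComponent,
      (∀ C' : (G.induce s).ConnectedComponent, C'.supp.ncard ≤ C.supp.ncard) ∧
        P (((G.induce s).induce C.supp).edgeSet.ncard) := by
  obtain ⟨u, hu, hmax⟩ := exists_max_image S (fun u => #(cluster G {u} S)) hS
  refine ⟨(G.induce s).connectedComponentMk ⟨u, (hs u).2 hu⟩, fun C' => ?_, ?_⟩
  · induction C' using SimpleGraph.ConnectedComponent.ind with
    | h v =>
      rw [ncard_supp hs, ncard_supp hs]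
      exact hmax _ ((hs _).1 v.2)
  · convert h u hu hmax using 1
    have := two_mul_ncard_edgeSet (G := G) hs ⟨u, (hs u).2 hu⟩
    rw [eq_div_iff two_ne_zero, mul_comm]
    exact_mod_cast this

end Components

section Expectation

theorem exp_three_mul_le {α : ℝ} (hα0 : 0 < α) (hα1 : α ≤ 1 / 1000) :
    Real.exp (3 * α) ≤ 1 + 6 * α := by
  have h3 : 1 - 3 * α ≤ Real.exp (-(3 * α)) := by linarith [Real.add_one_le_exp (-(3 * α))]
  rw [Real.exp_neg] at h3
  have h4 : 0 < Real.exp (3 * α) := Real.exp_pos _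
  have h5 := mul_le_mul_of_nonneg_right h3 h4.le
  rw [inv_mul_cancel₀ h4.ne'] at h5
  nlinarith

variable {V : Type*} [Fintype V] [DecidableEq V] {G : SimpleGraph V} [DecidableRel G.Adj]
  {d K H : ℕ} {ε x α p : ℝ}

theorem bexp_bigDegreeSum_le_survival (hG : G.IsRegularOfDegree d) (h0 : 0 < ε)
    (h1 : ε < 1 / 10) (hx : x ∈ Set.Ioo (0 : ℝ) 1) (h : x = (1 + ε) * (1 - Real.exp (-x)))
    (hα0 : 0 < α) (hα : α ≤ ε ^ 2 / 100) (hd0 : 0 < d) (hd : 1 ≤ α ^ 2 * d) (hK : 2 < K)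
    (hr : (1 + ε ^ 2 / 4)⁻¹ ^ (K - 2) ≤ α)
    (hM : ∀ D : Finset V, #D < K → (#(overlapping G ⌈(1 - α ^ 2) * d⌉₊ D) : ℝ) ≤ α * d / 2) :
    bexp ((1 + ε) / d) univ (fun S => (bigDegreeSum G K d S : ℝ)) ≤
      ((1 + ε) ^ 2 - (1 + ε - x) ^ 2 + 5 * α) * (Fintype.card V / d) := by
  have hd' : (0 : ℝ) < d := by exact_mod_cast hd0
  have hxε := lt_survival h0 h1 hx.1 h
  have hα1 : α ≤ 1 / 1000 := by nlinarith
  have hd1 : 1000 ≤ (d : ℝ) := by nlinarith [mul_le_mul hα1 hα1 hα0.le (by norm_num)]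
  have hp1 : (1 + ε) / d ≤ 1 := (div_le_one hd').2 (by linarith)
  have hαεd : 4 ≤ α * ε * d := by
    have : 100 * (α * d) * α ≤ (ε ^ 2) * (α * d) := by
      have := mul_le_mul_of_nonneg_left hα (mul_pos hα0 hd').le
      linarith
    nlinarith [mul_pos hα0 hd', mul_pos (mul_pos hα0 hd') h0]
  have key := bexp_bigDegreeSum_le (G := G) (m := ⌈(1 - α ^ 2) * d⌉₊) (K := K)
    (s := Real.exp (-(x + α) / d)) (s' := Real.exp (-(ε / 2) / d))
    (r := (1 + ε ^ 2 / 4)⁻¹) (M := α * d / 2) (p := (1 + ε) / d) (by positivity) hp1 hG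
    (Real.exp_pos _).le (by gcongr; linarith)
    (Real.exp_le_one_iff.2 (by rw [neg_div, neg_nonpos]; positivity)) (by positivity)
    (inv_le_one_of_one_le₀ (by nlinarith))
    (exp_le_step h0 h1 hx h hα0.le (by linarith) hd0 hαεd)
    (exp_step_le_of_small h0 h1 (by positivity) (by nlinarith) hd0 (Nat.le_ceil _)) hM hK
  refine key.trans ?_
  have hs : Real.exp (-(x + α) / d) ^ (2 * d) = Real.exp (-x) ^ 2 * Real.exp (-(2 * α)) := by
    rw [← Real.exp_nat_mul, ← Real.exp_nat_mul, ← Real.exp_add]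
    congr 1
    push_cast
    field_simp
    ring
  have hE := survival_exp h
  have e1 : (Fintype.card V : ℝ) * d * ((1 + ε) / d) ^ 2 = (1 + ε) ^ 2 * (Fintype.card V / d) := by
    field_simp
  have e2 : (1 + ε) / d * (α * d / 2) = (1 + ε) * α / 2 := by field_simp
  rw [hs, e1, e2, mul_right_comm]
  refine mul_le_mul_of_nonneg_right ?_ (by positivity)
  have h2 : 1 - 2 * α ≤ Real.exp (-(2 * α)) := by linarith [Real.add_one_le_exp (-(2 * α))]
  have h3 : (1 + ε) ^ 2 * (Real.exp (-x) ^ 2 * Real.exp (-(2 * α))) =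
      (1 + ε - x) ^ 2 * Real.exp (-(2 * α)) := by rw [← hE]; ring
  have h4 : (1 + ε - x) ^ 2 * (1 - 2 * α) ≤ (1 + ε - x) ^ 2 * Real.exp (-(2 * α)) := by gcongr
  have h5 : (1 + ε - x) ^ 2 ≤ 1 := pow_le_one₀ (by linarith [hx.2]) (by linarith)
  have h6 : (1 + ε) ^ 2 * ((1 + ε ^ 2 / 4)⁻¹ ^ (K - 2) + (1 + ε) * α / 2) ≤
      (1 + ε) ^ 2 * (α + (1 + ε) * α / 2) := by gcongr
  have h7 : (1 + ε) ^ 2 * (α + (1 + ε) * α / 2) ≤ 121 / 100 * (α + 11 / 10 * α / 2) := by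
    gcongr <;> nlinarith
  nlinarith

theorem le_survival_mul (h0 : 0 < ε) (h1 : ε < 1 / 10) (hx : x < 1)
    (hxε : 3 / 2 * ε < x) (hα0 : 0 < α) (hα : α ≤ ε ^ 2 / 100) {y : ℝ}
    (hy : (1 + ε) ^ 2 * y = (1 + ε - x) ^ 2) (hy0 : 0 ≤ y) :
    0 ≤ 1 - y - 8 * α ∧ (1 + ε) ^ 2 - (1 + ε - x) ^ 2 - 10 * α ≤
      (1 + ε - 2 * α ^ 2) ^ 2 * (1 - y - 8 * α) := by
  have hlow : 9 * α ≤ 1 - y := by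
    have hT : (1 + ε) ^ 2 * (1 - y) = x * (2 + 2 * ε - x) := by rw [mul_sub, hy]; ring
    by_contra! hc
    have h8 : (1 + ε) ^ 2 * (1 - y) ≤ (1 + ε) ^ 2 * (9 * α) := by gcongr
    have h9 : (1 + ε) ^ 2 * (9 * α) ≤ 121 / 100 * (9 * α) := by gcongr; nlinarith
    have h10 : x * 1 ≤ x * (2 + 2 * ε - x) := by gcongr <;> linarith
    nlinarith
  refine ⟨by linarith, ?_⟩
  have h8 : (1 + ε) ^ 2 - 5 * α ^ 2 ≤ (1 + ε - 2 * α ^ 2) ^ 2 := by nlinarith [sq_nonneg α]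
  have h9 := mul_le_mul_of_nonneg_right h8 (by linarith : 0 ≤ 1 - y - 8 * α)
  have h10 : (1 + ε) ^ 2 * (1 - y - 8 * α) =
    (1 + ε) ^ 2 - (1 + ε - x) ^ 2 - (1 + ε) ^ 2 * (8 * α) := by rw [← hy]; ring
  have h11 : (1 + ε) ^ 2 * (8 * α) ≤ 121 / 100 * (8 * α) := by gcongr; nlinarith
  have h12 : 5 * α ^ 2 * (1 - y - 8 * α) ≤ 5 * α ^ 2 * 1 := by gcongr; linarith
  have h13 : 5 * α ^ 2 ≤ α / 10 := by nlinarith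
  rw [sub_mul] at h9
  linarith

theorem le_bexp_bigDegreeSum_survival (hG : G.IsRegularOfDegree d) (h0 : 0 < ε)
    (h1 : ε < 1 / 10) (hx : x ∈ Set.Ioo (0 : ℝ) 1) (h : x = (1 + ε) * (1 - Real.exp (-x)))
    (hα0 : 0 < α) (hα : α ≤ ε ^ 2 / 100) (hd0 : 0 < d) (hd : 1 ≤ α ^ 2 * d) (hK : 2 < K)
    (hp : (1 + ε - 2 * α ^ 2) / d ≤ p) (hp' : p ≤ (1 + ε) / d)
    (hM : ∀ D : Finset V, #D < K → (#(overlapping G ⌈(1 - α ^ 2) * d⌉₊ D) : ℝ) ≤ α * d / 2) :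
    ((1 + ε) ^ 2 - (1 + ε - x) ^ 2 - 10 * α) * (Fintype.card V / d) ≤
      bexp p univ (fun S => (bigDegreeSum G K d S : ℝ)) := by
  have hd' : (0 : ℝ) < d := by exact_mod_cast hd0
  have hxε := lt_survival h0 h1 hx.1 h
  have hα1 : α ≤ 1 / 1000 := by nlinarith
  have hd1 : 1000 ≤ (d : ℝ) := by nlinarith [mul_le_mul hα1 hα1 hα0.le (by norm_num)]
  have hp1 : p ≤ 1 := hp'.trans ((div_le_one hd').2 (by linarith))
  have hpos : 0 < (1 + ε - 2 * α ^ 2) / d := div_pos (by nlinarith) hd'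
  have hp0 : 0 < p := hpos.trans_le hp
  set m := ⌈(1 - α ^ 2) * d⌉₊
  have hm : (1 - α ^ 2) * d ≤ m := Nat.le_ceil _
  have key := le_bexp_bigDegreeSum (G := G) (m := m) (K := K)
    (s := Real.exp (-(x - α) / d)) (M := α * d / 2) (p := p) hp0.le hp1 hG
    (Real.exp_pos _).le
    (Real.exp_le_one_iff.2 (by
      rw [neg_div, neg_nonpos]; exact div_nonneg (by nlinarith) hd'.le))
    (exp_step_le (η := α ^ 2) (θ := α ^ 2) h0 h1 hx h hα0.le (by nlinarith) hd0 (by positivity)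
      (by positivity) (by nlinarith) hp hm) hM hK
  refine le_trans ?_ key
  have hs : Real.exp (-(x - α) / d) ^ (d + m - 2) ≤ Real.exp (-x) ^ 2 * Real.exp (3 * α) := by
    rw [← Real.exp_nat_mul, ← Real.exp_nat_mul, ← Real.exp_add, Real.exp_le_exp]
    have hdm : 2 ≤ d + m := by
      have : (2 : ℝ) ≤ d := by linarith
      have : 2 ≤ d := by exact_mod_cast this
      omega
    rw [Nat.cast_sub hdm]
    push_cast
    have hk : (2 - α) * d ≤ d + m - 2 := by nlinarith
    have h3 : 0 ≤ (x - α) / d := div_nonneg (by nlinarith) hd'.le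
    have h4 := mul_le_mul_of_nonneg_right hk h3
    have h5 : (2 - α) * d * ((x - α) / d) = (2 - α) * (x - α) := by field_simp
    rw [neg_div]
    linarith [mul_lt_mul_of_pos_left hx.2 hα0, sq_nonneg α]
  have hE := survival_exp h
  have h2 := exp_three_mul_le hα0 hα1
  set y := Real.exp (-x) ^ 2
  have hy : (1 + ε) ^ 2 * y = (1 + ε - x) ^ 2 := by rw [← hE]; ring
  have hy0 : 0 ≤ y := by positivity
  have hpd : p * (α * d / 2) ≤ 6 / 10 * α := by
    have := mul_le_mul_of_nonneg_right hp' (by positivity : 0 ≤ α * d / 2)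
    have e2 : (1 + ε) / d * (α * d / 2) = (1 + ε) * α / 2 := by field_simp
    nlinarith
  have hin : d * (1 - y - 8 * α) ≤
      d * (1 - Real.exp (-(x - α) / d) ^ (d + m - 2) - p * (α * d / 2)) - α * d / 2 := by
    have hy1 : y ≤ 1 := pow_le_one₀ (Real.exp_pos _).le (Real.exp_le_one_iff.2 (by linarith [hx.1]))
    have h3 : y * Real.exp (3 * α) ≤ y + 6 * α := by
      linarith [mul_le_mul_of_nonneg_left h2 hy0, mul_le_mul_of_nonneg_right hy1 hα0.le]
    have h4 : 1 - y - 8 * α + α / 2 ≤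
        1 - Real.exp (-(x - α) / d) ^ (d + m - 2) - p * (α * d / 2) := by linarith
    linarith [mul_le_mul_of_nonneg_left h4 hd'.le]
  obtain ⟨hy8, hT⟩ := le_survival_mul h0 h1 hx.2 hxε hα0 hα hy hy0
  calc _ ≤ Fintype.card V * ((1 + ε - 2 * α ^ 2) / d) ^ 2 * (d * (1 - y - 8 * α)) := by
        have e : (Fintype.card V : ℝ) * ((1 + ε - 2 * α ^ 2) / d) ^ 2 * (d * (1 - y - 8 * α)) =
          (1 + ε - 2 * α ^ 2) ^ 2 * (1 - y - 8 * α) * (Fintype.card V / d) := by field_simp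
        rw [e]
        exact mul_le_mul_of_nonneg_right hT (by positivity)
    _ ≤ Fintype.card V * p ^ 2 * (d * (1 - y - 8 * α)) := by
        have : 0 ≤ d * (1 - y - 8 * α) := mul_nonneg hd'.le hy8
        gcongr
    _ ≤ _ := mul_le_mul_of_nonneg_left hin (by positivity)

theorem le_bexp_bigDegreeSum_truncated (hG : G.IsRegularOfDegree d) (h0 : 0 < ε)
    (h1 : ε < 1 / 10) (hd0 : 0 < d) (hp0 : 0 ≤ p) (hp1 : p ≤ 1) (hp' : p ≤ (1 + ε) / d)
    (hH : 0 < H) {T : ℝ}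
    (hT : T * (Fintype.card V / d) ≤ bexp p univ (fun S => (bigDegreeSum G K d S : ℝ))) :
    (T - 3 / H) * (Fintype.card V / d) ≤
      bexp p univ (fun S => (bigDegreeSum G K H S : ℝ)) := by
  have hd' : (0 : ℝ) < d := by exact_mod_cast hd0
  have hH' : (0 : ℝ) < H := by exact_mod_cast hH
  have key := bexp_sub_bigDegreeSum_le (K := K) hp0 hp1 hG hH
  have hpd : p * d ≤ 1 + ε := (le_div_iff₀ hd').1 hp'
  have hpd0 : 0 ≤ p * d := by positivity
  have h2 : Fintype.card V * p * (p * d + (p * d) ^ 2) / H ≤ 3 / H * (Fintype.card V / d) := by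
    have h3 : p * d * (p * d + (p * d) ^ 2) ≤ 11 / 10 * (11 / 10 + (11 / 10) ^ 2) := by
      gcongr <;> linarith
    have e : Fintype.card V * p * (p * d + (p * d) ^ 2) / H =
        p * d * (p * d + (p * d) ^ 2) / H * (Fintype.card V / d) := by field_simp
    rw [e]
    gcongr
    linarith
  linarith [sub_mul T (3 / H) (Fintype.card V / d : ℝ)]

end Expectation

section UnionBounds

variable {V : Type*} {U : Finset V} {p p₁ q : ℝ} {P P₁ P₂ : Finset V → Prop}

theorem bprob_or_le (h0 : 0 ≤ p) (h1 : p ≤ 1) :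
    bprob p U (fun S => P₁ S ∨ P₂ S) ≤ bprob p U P₁ + bprob p U P₂ := by
  rw [bprob, bprob, bprob, ← bexp_add]
  refine bexp_mono h0 h1 fun S _ => ?_
  by_cases hP : P₁ S <;> by_cases hQ : P₂ S <;> simp [hP, hQ]

/-- A union bound for a random set built in three rounds. -/
theorem bprob_le_of_rounds [DecidableEq V] (hp₁ : 0 ≤ p₁) (hp₁' : p₁ ≤ 1) (hq : 0 ≤ q)
    (hq' : q ≤ 1) (hp : p = 1 - (1 - (1 - (1 - p₁) * (1 - q))) * (1 - q))
    {P₃ : Finset V → Finset V → Finset V → Prop}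
    (h : ∀ S S' S'', P (S ∪ S' ∪ S'') → P₁ (S ∪ S' ∪ S'') ∨ P₂ S ∨ P₃ S S' S'') :
    bprob p U P ≤ bprob p U P₁ + bprob p₁ U P₂ +
      bexp p₁ U (fun S => bexp q U fun S' => bprob q U fun S'' => P₃ S S' S'') := by
  have key : ∀ Q : Finset V → Prop, bprob p U Q = bexp p₁ U (fun S => bexp q U fun S' =>
      bprob q U fun S'' => Q (S ∪ S' ∪ S'')) := by
    intro Q
    rw [hp, bprob, ← bexp_union, ← bexp_union]
    rfl
  rw [key, key, bprob, ← bexp_add, ← bexp_add]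
  refine bexp_mono hp₁ hp₁' fun S _ => ?_
  have e : (open Classical in if P₂ S then (1 : ℝ) else 0) =
      bexp q U fun _ => open Classical in if P₂ S then (1 : ℝ) else 0 := (bexp_const _).symm
  rw [e, ← bexp_add, ← bexp_add]
  refine bexp_mono hq hq' fun S' _ => ?_
  have e' : (open Classical in if P₂ S then (1 : ℝ) else 0) =
      bexp q U fun _ => open Classical in if P₂ S then (1 : ℝ) else 0 := (bexp_const _).symm
  rw [e', bprob, bprob, bprob, ← bexp_add, ← bexp_add]
  refine bexp_mono hq hq' fun S'' _ => ?_
  have := h S S' S''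
  split_ifs <;> first | (exfalso; tauto) | norm_num

theorem exists_first_round (hq : 0 ≤ q) (hq' : q < 1) (hp : 2 * q ≤ p) (hp' : p ≤ 1) :
    ∃ p₁, p - 2 * q ≤ p₁ ∧ p₁ ≤ p ∧ p = 1 - (1 - (1 - (1 - p₁) * (1 - q))) * (1 - q) := by
  have hQ : 0 < (1 - q) ^ 2 := pow_pos (by linarith) 2
  refine ⟨1 - (1 - p) / (1 - q) ^ 2, ?_, ?_, ?_⟩
  · have : (1 - p) / (1 - q) ^ 2 ≤ 1 - p + 2 * q := by
      rw [div_le_iff₀ hQ]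
      nlinarith [mul_nonneg hq (sub_nonneg.2 hp), mul_nonneg (sub_nonneg.2 hp') (sq_nonneg q),
        mul_nonneg hq (sq_nonneg q)]
    linarith
  · have : 1 - p ≤ (1 - p) / (1 - q) ^ 2 := by
      rw [le_div_iff₀ hQ]
      nlinarith [mul_nonneg (sub_nonneg.2 hp') hq,
        mul_nonneg (mul_nonneg (sub_nonneg.2 hp') hq) (by linarith : 0 ≤ 2 - q)]
    linarith
  · have hQ' : 1 - q ≠ 0 := by linarith
    field_simp
    ring

end UnionBounds

section Giant

variable {V : Type*} [Fintype V] [DecidableEq V] {G : SimpleGraph V} [DecidableRel G.Adj]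
  {d K H : ℕ} {ε x α p ζ β lam : ℝ}

theorem bprob_bigDegreeSum_le (hG : G.IsRegularOfDegree d) (hd : 0 < d) (hp0 : 0 ≤ p)
    (hp1 : p ≤ 1) (hpd : p * d ≤ 11 / 10) (hζ : 0 < ζ) (hN : 0 < Fintype.card V)
    (hβ : d ≤ β * Fintype.card V) :
    bprob p univ (fun S => ζ * (Fintype.card V / d) ≤
      |(bigDegreeSum G K H S : ℝ) - bexp p univ fun S => (bigDegreeSum G K H S : ℝ)|) ≤
      3 * (K ^ 2 + 2) ^ 2 / ζ ^ 2 * β := by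
  have hd' : (0 : ℝ) < d := by exact_mod_cast hd
  have hN' : (0 : ℝ) < Fintype.card V := by exact_mod_cast hN
  refine (bprob_bigDegreeSum hp0 hp1 hG (by positivity)).trans ?_
  have hpd0 : 0 ≤ p * d := by positivity
  have e : p * (Fintype.card V : ℝ) * (((K : ℝ) ^ 2 + 2) ^ 2 * (p * d + (p * d) ^ 2)) /
      (ζ * (Fintype.card V / d)) ^ 2 =
      (p * d * (p * d + (p * d) ^ 2)) * (((K : ℝ) ^ 2 + 2) ^ 2) / ζ ^ 2 *
        (d / Fintype.card V) := by field_simp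
  rw [e]
  have h3 : p * d * (p * d + (p * d) ^ 2) ≤ 11 / 10 * (11 / 10 + (11 / 10) ^ 2) := by
    gcongr
  have h4 : (d : ℝ) / Fintype.card V ≤ β := (div_le_iff₀ hN').2 hβ
  gcongr
  linarith

theorem bprob_sum_degIn_sq_le (hG : G.IsRegularOfDegree d) (hd : 0 < d) (hp0 : 0 ≤ p)
    (hp1 : p ≤ 1) (hpd : p * d ≤ 11 / 10) (hN : 0 < Fintype.card V)
    (hβ : d ≤ β * Fintype.card V) :
    bprob p univ (fun S => 6 * (Fintype.card V : ℝ) < ∑ w, (degIn G S w : ℝ) ^ 2) ≤ 2 * β := by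
  have hd' : (0 : ℝ) < d := by exact_mod_cast hd
  have hN' : (0 : ℝ) < Fintype.card V := by exact_mod_cast hN
  have hpd0 : 0 ≤ p * d := by positivity
  have hE := bexp_sum_degIn_sq_le hp0 hG
  have h3 : (Fintype.card V : ℝ) * (p * d + (p * d) ^ 2) ≤
      Fintype.card V * (11 / 10 + (11 / 10) ^ 2) := by gcongr
  refine (bprob_mono hp0 hp1 fun S _ h => ?_).trans
    ((bprob_sum_degIn_sq hp0 hp1 hG (by positivity : (0 : ℝ) < 3 * Fintype.card V)).trans ?_)
  · exact le_trans (by linarith) (le_abs_self _)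
  · have e : p * (Fintype.card V : ℝ) * (d ^ 2 * (8 * (p * d) + 4 * (p * d) ^ 2 + 1)) /
        (3 * Fintype.card V) ^ 2 =
        (p * d * (8 * (p * d) + 4 * (p * d) ^ 2 + 1)) / 9 * (d / Fintype.card V) := by
      field_simp
      ring
    rw [e]
    have h5 : p * d * (8 * (p * d) + 4 * (p * d) ^ 2 + 1) ≤
      11 / 10 * (8 * (11 / 10) + 4 * (11 / 10) ^ 2 + 1) := by gcongr
    have h4 : (d : ℝ) / Fintype.card V ≤ β := (div_le_iff₀ hN').2 hβ
    gcongr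
    linarith

/-- The number of edges of a largest component of a set obtained by sprinkling, when all relevant
quantities are close to their expectations. -/
theorem abs_sum_degIn_largest_sub_le (hG : G.IsRegularOfDegree d) {S S' S'' : Finset V}
    {R T : ℝ} (hR : 0 < R) (h0 : 0 < ε) (h1 : ε < 1) (hα0 : 0 < α) (hα : α ≤ ε ^ 2 / 10000)
    (hK : 1 < K) (hKR : K ≤ ε ^ 2 / 1000 * R)
    (hFd : (bigDegreeSum G K d (S ∪ S' ∪ S'') : ℝ) ≤ (T + 6 * α) * R)
    (hFH : (T - 14 * α) * R ≤ (bigDegreeSum G K ⌈1 / α⌉₊ S : ℝ))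
    (hF : ε * R ≤ (bigDegreeSum G K ⌈100 / ε⌉₊ S : ℝ))
    (hsplit : ¬ SplitBy G K (α ^ 2 * R) S S' S'') :
    (S ∪ S' ∪ S'').Nonempty ∧ ∀ u ∈ S ∪ S' ∪ S'', (∀ v ∈ S ∪ S' ∪ S'',
      #(cluster G {v} (S ∪ S' ∪ S'')) ≤ #(cluster G {u} (S ∪ S' ∪ S''))) →
        |(∑ v ∈ cluster G {u} (S ∪ S' ∪ S''), (degIn G (S ∪ S' ∪ S'') v : ℝ)) / 2 - T * R / 2| ≤
          9 * α * R := by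
  have hα1 : α ≤ 1 / 10000 := by nlinarith
  have hαR : 0 < α * R := by positivity
  have hα2 : α ^ 2 ≤ α / 10000 := by nlinarith
  have hα2R : α ^ 2 * R ≤ α / 10000 * R := by gcongr
  have hαε : α * R ≤ ε ^ 2 / 10000 * R := by gcongr
  have hX : ε ^ 2 / 101 * R ≤ #(bigVerts G K S) := by
    have h2 : (bigDegreeSum G K ⌈100 / ε⌉₊ S : ℝ) ≤ #(bigVerts G K S) * ⌈100 / ε⌉₊ := by
      rw [bigDegreeSum]
      exact_mod_cast sum_le_card_nsmul _ _ _ fun v _ => min_le_right _ _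
    have h3 : (⌈100 / ε⌉₊ : ℝ) ≤ 101 / ε := by
      have := (Nat.ceil_lt_add_one (by positivity : 0 ≤ 100 / ε)).le
      have h4 : 1 ≤ 1 / ε := by rw [le_div_iff₀ h0]; linarith
      have h5 : 101 / ε = 100 / ε + 1 / ε := by rw [← add_div]; norm_num
      linarith
    have h4 : ε * R ≤ #(bigVerts G K S) * (101 / ε) := hF.trans (h2.trans (by gcongr))
    rw [mul_div_assoc', le_div_iff₀ h0] at h4
    linarith
  have hH : α * ⌈1 / α⌉₊ ≤ 1 + α := by
    have := (Nat.ceil_lt_add_one (by positivity : 0 ≤ 1 / α)).le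
    have h2 := mul_le_mul_of_nonneg_left this hα0.le
    rwa [mul_add, mul_one_div_cancel hα0.ne', mul_one] at h2
  have hH' : 2 * (α ^ 2 * R) * ⌈1 / α⌉₊ ≤ 2 * (α * R) + 2 * (α ^ 2 * R) := by
    have := mul_le_mul_of_nonneg_left hH (by positivity : 0 ≤ 2 * (α * R))
    linarith
  obtain ⟨a, ha, hc⟩ := exists_card_sdiff_cluster_lt hsplit (by positivity) (by linarith)
  have hS : S ⊆ S ∪ S' ∪ S'' := subset_union_left.trans subset_union_left
  refine ⟨⟨a, hS (mem_bigVerts.1 ha).1⟩, fun u hu hmax => ?_⟩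
  obtain ⟨h2, h3⟩ := sum_degIn_largest hG hS hK ha hc.le (by linarith)
    (H := ⌈1 / α⌉₊) (by linarith) hu hmax
  rw [abs_le]
  constructor <;> linarith

/-- The event that `S` is nonempty and that its largest components have about `T * R / 2` edges,
up to an error of `δ * R`. -/
def HasLargestNear (G : SimpleGraph V) [DecidableRel G.Adj] (T δ R : ℝ) (S : Finset V) : Prop :=
  S.Nonempty ∧ ∀ u ∈ S, (∀ v ∈ S, #(cluster G {v} S) ≤ #(cluster G {u} S)) →
    |(∑ v ∈ cluster G {u} S, (degIn G S v : ℝ)) / 2 - T * R / 2| ≤ δ * R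

theorem inv_pow_sub_two_le (hα0 : 0 < α) (hα : α ≤ ε ^ 2)
    (hK : 6 ≤ K * α ^ 2) (hα1 : α ≤ 1) (hK2 : 2 < K) : (1 + ε ^ 2 / 4)⁻¹ ^ (K - 2) ≤ α := by
  rw [inv_pow]
  refine inv_le_of_inv_le₀ hα0 (le_trans ?_ (one_add_mul_le_pow (by nlinarith) _))
  rw [Nat.cast_sub hK2.le, inv_le_iff_one_le_mul₀ hα0]
  have h2 : (2 : ℝ) < K := by exact_mod_cast hK2
  have h3 : ((K : ℝ) - 2) * (α / 4) ≤ (K - 2) * (ε ^ 2 / 4) := by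
    gcongr
  have h4 := mul_le_mul_of_nonneg_right h3 hα0.le
  push_cast
  nlinarith

theorem exp_neg_le_of_mul {y b : ℝ} (hy : 0 < y) (h : 1 ≤ b * y) : Real.exp (-y) ≤ b := by
  rw [Real.exp_neg]
  refine inv_le_of_inv_le₀ (by nlinarith) (le_trans ?_ (Real.add_one_le_exp y))
  rw [inv_le_iff_one_le_mul₀ (by nlinarith)]
  nlinarith

theorem le_sq_sq_add_two (y : ℝ) : y ≤ (y ^ 2 + 2) ^ 2 := by
  nlinarith [sq_nonneg (y - 1), sq_nonneg (y ^ 2)]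

theorem card_overlapping_le_of_degree (hP : Pseudorandom G d lam) (hG : G.IsRegularOfDegree d)
    (hd : 0 < d) (hα0 : 0 < α) (hα1 : α ≤ 1 / 100) (hlam : lam ^ 2 ≤ α ^ 200 * d ^ 2)
    (hK : K * α ^ 24 ≤ 2) (hKd : (K : ℝ) * d ≤ α ^ 2 / 2 * Fintype.card V) (D : Finset V)
    (hD : #D < K) : (#(overlapping G ⌈(1 - α ^ 2) * d⌉₊ D) : ℝ) ≤ α * d / 2 := by
  have hd' : (0 : ℝ) < d := by exact_mod_cast hd
  refine (hP.card_overlapping_le hG hd (by positivity) hD hKd).trans ?_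
  rw [div_le_iff₀ (by positivity)]
  have h1 : 4 * lam ^ 2 * K ≤ 4 * (α ^ 200 * d ^ 2) * K := by gcongr
  have h2 : K * α ^ 24 * (4 * α ^ 171 * (α ^ 5 * d ^ 2)) ≤ 2 * (4 * α ^ 171 * (α ^ 5 * d ^ 2)) := by
    gcongr
  have h3 : α ^ 171 ≤ 1 / 100 := (pow_le_of_le_one hα0.le (by linarith) (by norm_num)).trans hα1
  have h4 : α ^ 171 * (α ^ 5 * d ^ 2) ≤ 1 / 100 * (α ^ 5 * d ^ 2) := by gcongr
  have h5 : 0 < α ^ 5 * (d : ℝ) ^ 2 := by positivity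
  calc _ ≤ 4 * (α ^ 200 * d ^ 2) * K := h1
    _ = K * α ^ 24 * (4 * α ^ 171 * (α ^ 5 * d ^ 2)) := by ring
    _ ≤ 1 / 2 * (α ^ 5 * d ^ 2) := by linarith
    _ = _ := by ring

set_option maxHeartbeats 1000000 in
/-- A largest component of a random subset of a pseudorandom graph has the expected number of
edges, with high probability. -/
theorem bprob_not_hasLargestNear_le (hP : Pseudorandom G d lam) (hG : G.IsRegularOfDegree d)
    (hd : 0 < d) (h0 : 0 < ε) (h1 : ε < 1 / 100) (hx : x ∈ Set.Ioo (0 : ℝ) 1)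
    (h : x = (1 + ε) * (1 - Real.exp (-x))) (hα0 : 0 < α) (hα : α < ε ^ 8)
    (hlam : lam ^ 2 ≤ α ^ 200 * d ^ 2) (hK : 1 ≤ K * α ^ 24) (hK' : K * α ^ 24 ≤ 2) {b : ℝ}
    (hb0 : 0 < b) (hb1 : b ≤ 1) (hN : 0 < Fintype.card V)
    (hβ : d ≤ b * (α ^ 2 / (40 * (K ^ 2 + 2) ^ 2)) * Fintype.card V) :
    bprob ((1 + ε) / d) univ (fun S => ¬ HasLargestNear G ((1 + ε) ^ 2 - (1 + ε - x) ^ 2) (9 * α)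
      (Fintype.card V / d) S) ≤ b := by
  have hd' : (0 : ℝ) < d := by exact_mod_cast hd
  have hN' : (0 : ℝ) < Fintype.card V := by exact_mod_cast hN
  have hε8 : ε ^ 8 ≤ ε ^ 2 / 1000000 := by
    have : ε ^ 6 ≤ (1 / 100) ^ 6 := by gcongr
    have h2 : ε ^ 8 = ε ^ 2 * ε ^ 6 := by ring
    rw [h2]
    have := mul_le_mul_of_nonneg_left this (sq_nonneg ε)
    linarith [sq_nonneg ε]
  have hαε : α ≤ ε ^ 2 / 1000000 := hα.le.trans hε8
  have hεsq : ε ^ 2 ≤ ε / 100 := by nlinarith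
  have hα1 : α ≤ 1 / 1000000 := by linarith
  have hpow : ∀ k ≠ 0, α ^ k ≤ 1 / 1000000 := fun k hk =>
    (pow_le_of_le_one hα0.le (by linarith) hk).trans hα1
  have hKbig : ∀ k < 24, 1000000 ≤ K * α ^ k := by
    intro k hk
    have e : K * α ^ 24 = (K * α ^ k) * α ^ (24 - k) := by
      rw [mul_assoc, ← pow_add]
      congr 2
      omega
    rw [e] at hK
    have h2 := mul_le_mul_of_nonneg_left (hpow (24 - k) (by omega))
      (by positivity : 0 ≤ K * α ^ k)
    linarith
  have hKr : (1000000 : ℝ) ≤ K := by simpa using hKbig 0 (by norm_num)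
  have hK2 : 2 < K := by
    have : (2 : ℝ) < K := by linarith
    exact_mod_cast this
  set β := b * (α ^ 2 / (40 * ((K : ℝ) ^ 2 + 2) ^ 2)) with hβdef
  have hβ0 : 0 < β := by positivity
  set R : ℝ := Fintype.card V / d with hR
  have hR0 : 0 < R := by positivity
  have hβR : 1 ≤ β * R := by
    rw [hR, mul_div_assoc', le_div_iff₀ hd']
    linarith
  have hβeq : β * (40 * (K ^ 2 + 2) ^ 2 / α ^ 2) = b := by
    rw [hβdef]
    field_simp
  have hK4 := le_sq_sq_add_two (K : ℝ)
  have hKβ : K * β ≤ α ^ 2 / 40 := by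
    have h3 : K * β ≤ (K ^ 2 + 2) ^ 2 * β := by gcongr
    have h4 : (K ^ 2 + 2) ^ 2 * β = b * (α ^ 2 / 40) := by
      rw [hβdef]
      field_simp
    have h5 : b * (α ^ 2 / 40) ≤ 1 * (α ^ 2 / 40) := by gcongr
    linarith
  have hKd : (K : ℝ) * d ≤ α ^ 2 / 2 * Fintype.card V := by
    have h2 : (K : ℝ) * d ≤ K * (β * Fintype.card V) := by gcongr
    have h3 : K * β * Fintype.card V ≤ α ^ 2 / 40 * Fintype.card V := by gcongr
    have h4 : α ^ 2 / 40 * (Fintype.card V : ℝ) ≤ α ^ 2 / 2 * Fintype.card V := by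
      gcongr
      norm_num
    linarith
  have hKR : (K : ℝ) ≤ ε ^ 2 / 1000 * R := by
    have h2 : (K : ℝ) * 1 ≤ K * (β * R) := by gcongr
    have h3 : K * β * R ≤ α ^ 2 / 40 * R := by gcongr
    have h4 : α ^ 2 / 40 * R ≤ ε ^ 2 / 1000 * R :=
      mul_le_mul_of_nonneg_right
        (by linarith [mul_le_mul_of_nonneg_left hα1 hα0.le, sq_nonneg ε]) hR0.le
    linarith
  have hd2 : 1 ≤ α ^ 2 * d := by
    have : Nonempty V := Fintype.card_pos_iff.1 hN
    have h2 : 2 * (d : ℝ) ≤ Fintype.card V := by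
      have h3 : (4 : ℝ) * d ≤ K * d := by gcongr; linarith
      have h4 : α ^ 2 / 2 * (Fintype.card V : ℝ) ≤ 1 * Fintype.card V := by
        gcongr
        linarith [hpow 2 (by norm_num)]
      linarith
    have h3 := (hP.le_sq hG h2).trans hlam
    have h4 : 1 / 4 ≤ α ^ 198 * (α ^ 2 * d) := by
      have e : α ^ 200 * (d : ℝ) ^ 2 = α ^ 198 * (α ^ 2 * d) * d := by ring
      rw [e] at h3
      refine le_of_mul_le_mul_right ?_ hd'
      linarith
    have h5 := mul_le_mul_of_nonneg_right (hpow 198 (by norm_num))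
      (by positivity : 0 ≤ α ^ 2 * (d : ℝ))
    linarith
  have hdR : 1000 ≤ (d : ℝ) := by
    have := mul_le_mul_of_nonneg_right (hpow 2 (by norm_num)) hd'.le
    linarith
  have hM := card_overlapping_le_of_degree hP hG hd hα0 (by linarith) hlam hK' hKd
  have hα100 : α ≤ ε ^ 2 / 100 := by linarith
  have hε10 : ε < 1 / 10 := by linarith
  have hp0 : 0 ≤ (1 + ε) / d := by positivity
  have hp1 : (1 + ε) / d ≤ 1 := (div_le_one hd').2 (by linarith)
  have hq0 : 0 ≤ α ^ 2 / d := by positivity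
  have hα2 := hpow 2 (by norm_num)
  have hq1 : α ^ 2 / d < 1 := (div_lt_one hd').2 (by linarith)
  obtain ⟨p₁, hpl, hpu, hp⟩ := exists_first_round hq0 hq1 (p := (1 + ε) / d)
    (by rw [mul_div_assoc']; gcongr; linarith) hp1
  have hpl' : (1 + ε - 2 * α ^ 2) / d ≤ p₁ := by
    rwa [sub_div, ← mul_div_assoc']
  have hp₁0 : 0 ≤ p₁ := (div_nonneg (by linarith) hd'.le).trans hpl'
  have hp₁1 : p₁ ≤ 1 := hpu.trans hp1
  have hpd : (1 + ε) / d * d ≤ 11 / 10 := by rw [div_mul_cancel₀ _ hd'.ne']; linarith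
  have hp₁d : p₁ * d ≤ 11 / 10 := (mul_le_mul_of_nonneg_right hpu hd'.le).trans hpd
  set T := (1 + ε) ^ 2 - (1 + ε - x) ^ 2 with hT
  have hTε : 3 / 2 * ε ≤ T := by
    have := lt_survival h0 hε10 hx.1 h
    have e : T = x * (2 + 2 * ε - x) := by rw [hT]; ring
    have h2 : x * 1 ≤ x * (2 + 2 * ε - x) :=
      mul_le_mul_of_nonneg_left (by linarith [hx.2]) hx.1.le
    linarith
  have hU := bexp_bigDegreeSum_le_survival hG h0 hε10 hx h hα0 hα100 hd hd2 hK2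
    (inv_pow_sub_two_le hα0 (by linarith [sq_nonneg ε])
      (by linarith [hKbig 2 (by norm_num)]) (by linarith) hK2) hM
  have hL := le_bexp_bigDegreeSum_survival hG h0 hε10 hx h hα0 hα100 hd hd2 hK2 hpl' hpu hM
  have hLH := le_bexp_bigDegreeSum_truncated (H := ⌈1 / α⌉₊) hG h0 hε10 hd hp₁0 hp₁1 hpu
    (Nat.ceil_pos.2 (by positivity)) hL
  have hLF := le_bexp_bigDegreeSum_truncated (H := ⌈100 / ε⌉₊) hG h0 hε10 hd hp₁0 hp₁1 hpu
    (Nat.ceil_pos.2 (by positivity)) hL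
  have hLH' : (T - 13 * α) * R ≤ bexp p₁ univ (fun S => (bigDegreeSum G K ⌈1 / α⌉₊ S : ℝ)) := by
    refine le_trans ?_ hLH
    have : 3 / (⌈1 / α⌉₊ : ℝ) ≤ 3 / (1 / α) := by
      gcongr
      exact Nat.le_ceil _
    rw [div_div_eq_mul_div, div_one] at this
    exact mul_le_mul_of_nonneg_right (by linarith) hR0.le
  have hLF' : (ε + α) * R ≤ bexp p₁ univ (fun S => (bigDegreeSum G K ⌈100 / ε⌉₊ S : ℝ)) := by
    refine le_trans ?_ hLF
    have : 3 / (⌈100 / ε⌉₊ : ℝ) ≤ 3 / (100 / ε) := by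
      gcongr
      exact Nat.le_ceil _
    rw [div_div_eq_mul_div] at this
    exact mul_le_mul_of_nonneg_right (by linarith) hR0.le
  refine (bprob_le_of_rounds hp₁0 hp₁1 hq0 hq1.le hp
    (P₁ := fun S => α * R ≤ |(bigDegreeSum G K d S : ℝ) -
      bexp ((1 + ε) / d) univ fun S => (bigDegreeSum G K d S : ℝ)| ∨
        6 * (Fintype.card V : ℝ) < ∑ w, (degIn G S w : ℝ) ^ 2)
    (P₂ := fun S => α * R ≤ |(bigDegreeSum G K ⌈1 / α⌉₊ S : ℝ) -
      bexp p₁ univ fun S => (bigDegreeSum G K ⌈1 / α⌉₊ S : ℝ)| ∨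
        α * R ≤ |(bigDegreeSum G K ⌈100 / ε⌉₊ S : ℝ) -
      bexp p₁ univ fun S => (bigDegreeSum G K ⌈100 / ε⌉₊ S : ℝ)|)
    (P₃ := fun S S' S'' => SplitBy G K (α ^ 2 * R) S S' S'' ∧
        ∑ w, (degIn G (S ∪ S' ∪ S'') w : ℝ) ^ 2 ≤ 6 * Fintype.card V) ?_).trans ?_
  · intro S S' S'' hbad
    by_contra! hgood
    obtain ⟨⟨hF1, hD⟩, ⟨hF2, hF3⟩, hsp⟩ := hgood
    refine hbad (abs_sum_degIn_largest_sub_le (ε := ε) hG hR0 h0 (by linarith) hα0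
      (by linarith [sq_nonneg ε]) (by omega) hKR ?_ ?_ ?_ fun hs => (hsp hs).not_ge hD)
    · linarith [(abs_lt.1 hF1).2]
    · linarith [(abs_lt.1 hF2).1]
    · linarith [(abs_lt.1 hF3).1]
  · have b1 := bprob_bigDegreeSum_le (K := K) (H := d) hG hd hp0 hp1 hpd hα0 hN hβ
    have b2 := bprob_sum_degIn_sq_le hG hd hp0 hp1 hpd hN hβ
    have b3 := bprob_bigDegreeSum_le (K := K) (H := ⌈1 / α⌉₊) hG hd hp₁0 hp₁1 hp₁d hα0 hN hβ
    have b4 := bprob_bigDegreeSum_le (K := K) (H := ⌈100 / ε⌉₊) hG hd hp₁0 hp₁1 hp₁d hα0 hN hβ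
    obtain ⟨μ, hμ⟩ : ∃ μ, μ = (α ^ 2) ^ 2 / 6 := ⟨_, rfl⟩
    obtain ⟨ν, hν⟩ : ∃ ν, ν = (α ^ 2 * μ ^ 2 / 16) ^ 2 / 6 := ⟨_, rfl⟩
    have eν : ν = α ^ 20 / 1990656 := by rw [hν, hμ]; ring
    have hν0 : 0 < ν := by rw [eν]; positivity
    have hνμ : ν ≤ μ / 8 := by
      rw [eν, hμ]
      have := mul_le_mul_of_nonneg_left (hpow 16 (by norm_num)) (by positivity : 0 ≤ α ^ 4)
      linarith [pow_pos hα0 4]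
    have hlam' : 8 * lam ^ 2 ≤ μ ^ 2 * d ^ 2 := by
      rw [hμ]
      have h2 := mul_le_mul_of_nonneg_left (hpow 192 (by norm_num))
        (by positivity : 0 ≤ α ^ 8 * (d : ℝ) ^ 2)
      have e : α ^ 200 * (d : ℝ) ^ 2 = α ^ 8 * d ^ 2 * α ^ 192 := by ring
      have h3 : 0 ≤ α ^ 8 * (d : ℝ) ^ 2 := by positivity
      rw [e] at hlam
      linarith
    have hKν : 12 ≤ α ^ 2 * ν * K := by
      have e : α ^ 2 * ν * K = K * α ^ 22 / 1990656 := by rw [eν]; ring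
      have e2 : K * α ^ 23 = K * α ^ 22 * α := by ring
      have h2 := hKbig 23 (by norm_num)
      rw [e2] at h2
      have h3 : K * α ^ 22 * α ≤ K * α ^ 22 * (1 / 1000000) := by gcongr
      rw [e]
      linarith
    have b5 := bexp_splitBy_le (p := p₁) (c := α ^ 2) hP hG hd hp₁0 hp₁1 (by positivity)
      (by linarith) (by positivity) hμ hν hνμ hlam' hKν
    have b6 : Real.exp (-(α ^ 2 * ν / 2 * R)) ≤ K * β := by
      refine exp_neg_le_of_mul (by positivity) ?_
      have e : K * β * (α ^ 2 * ν / 2 * R) = (α ^ 2 * ν * K) / 2 * (β * R) := by ring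
      rw [e]
      exact one_le_mul_of_one_le_of_one_le (by linarith) hβR
    have b7 := bprob_or_le (U := (univ : Finset V)) hp0 hp1
      (P₁ := fun S => α * R ≤ |(bigDegreeSum G K d S : ℝ) -
      bexp ((1 + ε) / d) univ fun S => (bigDegreeSum G K d S : ℝ)|)
      (P₂ := fun S => 6 * (Fintype.card V : ℝ) < ∑ w, (degIn G S w : ℝ) ^ 2)
    have b8 := bprob_or_le (U := (univ : Finset V)) hp₁0 hp₁1
      (P₁ := fun S => α * R ≤ |(bigDegreeSum G K ⌈1 / α⌉₊ S : ℝ) -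
      bexp p₁ univ fun S => (bigDegreeSum G K ⌈1 / α⌉₊ S : ℝ)|)
      (P₂ := fun S => α * R ≤ |(bigDegreeSum G K ⌈100 / ε⌉₊ S : ℝ) -
      bexp p₁ univ fun S => (bigDegreeSum G K ⌈100 / ε⌉₊ S : ℝ)|)
    set B : ℝ := ((K : ℝ) ^ 2 + 2) ^ 2 / α ^ 2 with hB
    have hB1 : K ≤ B := by
      rw [hB, le_div_iff₀ (by positivity)]
      exact (mul_le_of_le_one_right (by positivity) (by linarith)).trans hK4
    have e3 : 3 * ((K : ℝ) ^ 2 + 2) ^ 2 / α ^ 2 * β = 3 * (B * β) := by rw [hB]; ring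
    have e4 : 40 * (B * β) = b := by rw [← hβeq, hB]; ring
    have h8 : K * β ≤ B * β := by gcongr
    have h9 : 1 * β ≤ K * β := by gcongr; linarith
    rw [e3] at b1 b3 b4
    linarith

end Giant

section Numerics

variable {n d : ℕ} {lam α : ℝ} {G : SimpleGraph (Fin n)}

theorem IsNDLGraph.nonneg (h : IsNDLGraph n d lam G) (hn : 2 ≤ n) : 0 ≤ lam := by
  obtain ⟨-, i₀, -, hi⟩ := h
  have : Nontrivial (Fin n) := Fin.nontrivial_iff_two_le.2 hn
  obtain ⟨i, hne⟩ := exists_ne i₀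
  exact (abs_nonneg _).trans (hi i hne)

theorem le_pow_hundred_mul (hα0 : 0 < α) (hα : α ≤ 1 / 50) (hd : 0 < d)
    (h : lam / d ≤ α ^ ((2 : ℝ) / α)) : lam ≤ α ^ 100 * d := by
  rw [← div_le_iff₀ (by exact_mod_cast hd), ← Real.rpow_natCast]
  refine h.trans (Real.rpow_le_rpow_of_exponent_ge hα0 (by linarith) ?_)
  rw [le_div_iff₀ hα0]
  push_cast
  linarith

theorem nine_mul_le_eight_mul_rpow (hα0 : 0 < α) (hα : α ≤ 1 / 10000) :
    9 * α ≤ 8 * α ^ ((1 : ℝ) / 4) := by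
  have h : α ≤ α ^ ((1 : ℝ) / 4) * (1 / 10000) ^ ((3 : ℝ) / 4) := by
    calc α = α ^ ((1 : ℝ) / 4) * α ^ ((3 : ℝ) / 4) := by
          rw [← Real.rpow_add hα0]; norm_num
      _ ≤ _ := by gcongr
  have h2 : ((1 : ℝ) / 10000) ^ ((3 : ℝ) / 4) = 1 / 1000 := by
    rw [show (1 : ℝ) / 10000 = (1 / 10) ^ (4 : ℝ) by norm_num, ← Real.rpow_mul (by norm_num)]
    norm_num
  rw [h2] at h
  linarith

end Numerics

/-- There is `ε₀ > 0` such that for every `ε ∈ (0, ε₀)`: the equation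
`x = (1+ε)(1-e^{-x})` has a unique solution `x ∈ (0,1)`, and for this `x`, for every
`α ∈ (0, ε⁸)` and `γ > 0` there are `β > 0` and `n₀` such that for all `n ≥ n₀`,
all `d` with `1 + ε ≤ d ≤ β n`, and every `(n,d,λ)`-graph `G` with `λ/d ≤ α^{2/α}`,
with probability at least `1 - γ` the number of edges of a largest connected
component `L₁` of the percolated subgraph satisfies
`|e(L₁) - ((1+ε)² - (1+ε-x)²) n/(2d)| ≤ 8 α^{1/4} n / d`. -/
theorem giant_component_edges :
    ∃ ε₀ > (0 : ℝ), ∀ ε : ℝ, 0 < ε → ε < ε₀ →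
      (∃! x : ℝ, x ∈ Set.Ioo (0 : ℝ) 1 ∧ x = (1 + ε) * (1 - Real.exp (-x))) ∧
      ∀ x : ℝ, x ∈ Set.Ioo (0 : ℝ) 1 → x = (1 + ε) * (1 - Real.exp (-x)) →
        ∀ α : ℝ, 0 < α → α < ε ^ 8 →
          ∀ γ > (0 : ℝ), ∃ β > (0 : ℝ), ∃ n₀ : ℕ,
            ∀ n : ℕ, n₀ ≤ n → ∀ d : ℕ, 1 + ε ≤ (d : ℝ) → (d : ℝ) ≤ β * n →
              ∀ (lam : ℝ) (G : SimpleGraph (Fin n)),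
                IsNDLGraph n d lam G → lam / d ≤ α ^ ((2 : ℝ) / α) →
                  ENNReal.ofReal (1 - γ) ≤
                    percolationMeasure (Fin n) ((1 + ε) / d)
                      {ω : Fin n → Bool |
                        ∃ C : (G.induce (percSet ω)).ConnectedComponent,
                          (∀ C' : (G.induce (percSet ω)).ConnectedComponent,
                            C'.supp.ncard ≤ C.supp.ncard) ∧
                          |((((G.induce (percSet ω)).induce C.supp).edgeSet.ncard : ℝ)) -
                              ((1 + ε) ^ 2 - (1 + ε - x) ^ 2) * n / (2 * d)| ≤
                            8 * α ^ ((1 : ℝ) / 4) * n / d} := by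
  refine ⟨1 / 100, by norm_num, fun ε h0 h1 => ⟨existsUnique_survival h0 (by linarith), ?_⟩⟩
  intro x hx h α hα0 hα γ hγ
  have hα1 : α ≤ 1 / 10000 := by
    have : ε ^ 8 ≤ (1 / 100) ^ 8 := by gcongr
    linarith
  have hα24 : 0 < α ^ 24 := by positivity
  obtain ⟨K, hK, hK'⟩ : ∃ K : ℕ, 1 ≤ K * α ^ 24 ∧ K * α ^ 24 ≤ 2 := by
    refine ⟨⌈(α ^ 24)⁻¹⌉₊, (inv_le_iff_one_le_mul₀ hα24).1 (Nat.le_ceil _), ?_⟩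
    have h2 := mul_le_mul_of_nonneg_right
      (Nat.ceil_lt_add_one (inv_nonneg.2 hα24.le)).le hα24.le
    rw [add_mul, inv_mul_cancel₀ hα24.ne'] at h2
    linarith [pow_le_one₀ (n := 24) hα0.le (by linarith)]
  refine ⟨min γ 1 * (α ^ 2 / (40 * (K ^ 2 + 2) ^ 2)), by positivity, 2, ?_⟩
  intro n hn d hd hβ lam G hG hlam
  let := Classical.decRel G.Adj
  have hd' : (0 : ℝ) < d := by linarith
  have hd0 : 0 < d := by exact_mod_cast hd'
  have hlam0 := hG.nonneg hn
  have hlam1 := le_pow_hundred_mul hα0 (by linarith) hd0 hlam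
  have hlamd : lam < d := by
    have := pow_le_of_le_one hα0.le (by linarith) (by norm_num : 100 ≠ 0)
    have := mul_le_mul_of_nonneg_right this hd'.le
    nlinarith
  have hlam2 : lam ^ 2 ≤ α ^ 200 * d ^ 2 := by
    calc lam ^ 2 ≤ (α ^ 100 * d) ^ 2 := by gcongr
      _ = _ := by ring
  have hp0 : 0 ≤ (1 + ε) / d := by positivity
  have hp1 : (1 + ε) / d ≤ 1 := (div_le_one hd').2 hd
  have key := bprob_not_hasLargestNear_le (hG.pseudorandom hlamd) hG.1 hd0 h0 h1 hx h hα0 hα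
    hlam2 hK hK' (lt_min hγ one_pos) (min_le_right γ 1) (by simp; omega) (by simpa using hβ)
  rw [bprob_not, Fintype.card_fin] at key
  calc ENNReal.ofReal (1 - γ) ≤ ENNReal.ofReal (bprob ((1 + ε) / d) univ (HasLargestNear G
        ((1 + ε) ^ 2 - (1 + ε - x) ^ 2) (9 * α) (n / d))) :=
      ENNReal.ofReal_le_ofReal (by linarith [min_le_left γ 1])
    _ = _ := (percolationMeasure_setOf hp0 hp1 _).symm
    _ ≤ _ := by
      refine MeasureTheory.measure_mono fun ω ⟨hne, hω⟩ => ?_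
      refine exists_largest_component (G := G) (s := percSet ω) (by simp [percSet]) hne
        (P := fun e => |e - ((1 + ε) ^ 2 - (1 + ε - x) ^ 2) * n / (2 * d)| ≤
          8 * α ^ ((1 : ℝ) / 4) * n / d) fun u hu hmax => ?_
      have e : ((1 + ε) ^ 2 - (1 + ε - x) ^ 2) * n / (2 * d) =
          ((1 + ε) ^ 2 - (1 + ε - x) ^ 2) * (n / d) / 2 := by
        field_simp
      rw [e, mul_div_assoc (8 * α ^ ((1 : ℝ) / 4))]
      exact (hω u hu hmax).trans
        (mul_le_mul_of_nonneg_right (nine_mul_le_eight_mul_rpow hα0 hα1) (by positivity))
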